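/- Set p = 1/2 (so b = 2). Let β be an integer-valued function defined on a subset W of ℝ which is a union of intervals, constant on each interval, and such that for some constant ε > 0, α₀(n) − 1 − 2/log 2 + ε ≤ β(n) ≤ α₀(n) + 100 for all large enough n. For n ∈ W let I_n = [n/(β(n)−ε/4), n/(α₀(n)−100)]. Then for each large enough real n ∈ W there is a unique k* = k*(n) ∈ I_n such that L̂₀(n, k*(n), β(n)) = 0. Furthermore, n/k*(n) = α(n) − 1 − 2/log 2 + log(μ_{α(n)}(n))/(log n − log log n) + O(1/log n), and if n is an integer then k*(n) − k_{β(n)}(n) = O(log² n). -/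

import Mathlib

open Filter Real

/-- Number of edges of a graph on `Fin n`. -/
noncomputable def edgeCount {n : ℕ} (G : SimpleGraph (Fin n)) : ℕ := G.edgeSet.ncard

/-- The probability that the binomial random graph `G_{n,p}` equals `G`. -/
noncomputable def gnpWeight (n : ℕ) (p : ℝ) (G : SimpleGraph (Fin n)) : ℝ :=
  p ^ edgeCount G * (1 - p) ^ (n.choose 2 - edgeCount G)

/-- `P` is a partition of the vertex set of `G` into independent sets, each of size at most
`t`. -/
def IsIndepPartition {n : ℕ} (G : SimpleGraph (Fin n)) (t : ℕ)
    (P : Finset (Finset (Fin n))) : Prop :=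
  (∀ S ∈ P, S.Nonempty ∧ S.card ≤ t ∧ ∀ u ∈ S, ∀ v ∈ S, ¬ G.Adj u v) ∧
  (∀ v : Fin n, ∃! S, S ∈ P ∧ v ∈ S)

/-- The number of unordered `t`-bounded `k`-colourings of `G`. -/
noncomputable def numPartitions {n : ℕ} (k t : ℕ) (G : SimpleGraph (Fin n)) : ℕ :=
  Set.ncard {P : Finset (Finset (Fin n)) | P.card = k ∧ IsIndepPartition G t P}

/-- `E_{n,k,t}`: expected number of unordered `t`-bounded `k`-colourings of `G_{n,1/2}`. -/
noncomputable def EE (n k t : ℕ) : ℝ :=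
  ∑ G : SimpleGraph (Fin n), gnpWeight n (1 / 2) G * numPartitions k t G

/-- `k_t(n) = min {k : E_{n,k,t} ≥ 1}`, the `t`-bounded first moment threshold. -/
noncomputable def kThresh (n t : ℕ) : ℕ := sInf {k : ℕ | 1 ≤ EE n k t}

/-- `α₀(n)` (for `p = 1/2`, take `b = 2`). -/
noncomputable def alpha0 (b : ℝ) (x : ℝ) : ℝ :=
  2 * Real.logb b x - 2 * Real.logb b (Real.logb b x) + 2 * Real.logb b (Real.exp 1 / 2) + 1

/-- `α(n) = ⌊α₀(n)⌋`, as a natural number. -/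
noncomputable def alphaNat (b : ℝ) (x : ℝ) : ℕ := (⌊alpha0 b x⌋).toNat

/-- `μ_a(x) = C(x,a) q^C(a,2)` extended to a real variable `x` via the falling factorial. -/
noncomputable def muR (q : ℝ) (a : ℕ) (x : ℝ) : ℝ :=
  (∏ i ∈ Finset.range a, (x - i)) / (a.factorial : ℝ) * q ^ a.choose 2

/-- `d_i = 2^C(i,2) i!`. -/
noncomputable def dI (i : ℕ) : ℝ := 2 ^ i.choose 2 * (i.factorial : ℝ)

/-- `P̃_{ρ,t}`: the set of `(p_1,…,p_t) ∈ [0,1]^t` with `Σ p_i = 1` and `Σ i p_i = ρ`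
(index `i : Fin t` denotes size `i+1`). -/
def Ptilde (ρ : ℝ) (t : ℕ) : Set (Fin t → ℝ) :=
  {q | (∀ i, q i ∈ Set.Icc (0 : ℝ) 1) ∧ (∑ i, q i) = 1 ∧
    (∑ i, ((i.1 + 1 : ℕ) : ℝ) * q i) = ρ}

/-- `L̃(ρ,k,p) = ρ log(ρk) − log k − ρ + 1 − Σ p_i log(p_i d_i)`. -/
noncomputable def Ltilde (ρ k : ℝ) {t : ℕ} (q : Fin t → ℝ) : ℝ :=
  ρ * Real.log (ρ * k) - Real.log k - ρ + 1 -
    ∑ i, q i * Real.log (q i * dI (i.1 + 1))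

/-- `L̃₀(ρ,k,t) = sup {L̃(ρ,k,p) : p ∈ P̃_{ρ,t}}`. -/
noncomputable def Ltilde0 (ρ k : ℝ) (t : ℕ) : ℝ :=
  sSup {L : ℝ | ∃ q ∈ Ptilde ρ t, L = Ltilde ρ k q}

/-- `L̂₀(n,k,t) = L̃₀(n/k, k, t)`. -/
noncomputable def Lhat0 (n k : ℝ) (t : ℕ) : ℝ := Ltilde0 (n / k) k t

/-- The number of functions `Fin m → ι` with prescribed fibre sizes is a multinomial
coefficient. -/
theorem card_fiberCount_eq_multinomial {ι : Type*} [Fintype ι] [DecidableEq ι] {m : ℕ}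
    {c : ι → ℕ} (hc : ∑ j, c j = m) :
    (Finset.univ.filter fun f : Fin m → ι =>
      (fun j => (Finset.univ.filter fun i => f i = j).card) = c).card =
      Nat.multinomial Finset.univ c := by
  classical
  have h1 : (∑ j, (MvPolynomial.X j : MvPolynomial ι ℤ)) ^ m =
      ∑ f : Fin m → ι, MvPolynomial.monomial
        (Finsupp.equivFunOnFinite.symm
          fun j => (Finset.univ.filter fun i => f i = j).card) (1 : ℤ) := by
    have : (∑ j, (MvPolynomial.X j : MvPolynomial ι ℤ)) ^ m =
        ∏ _i : Fin m, ∑ j, (MvPolynomial.X j : MvPolynomial ι ℤ) := by simp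
    rw [this, Finset.prod_univ_sum]
    simp only [Fintype.piFinset_univ]
    refine Finset.sum_congr rfl fun f _ => ?_
    rw [MvPolynomial.monomial_eq, Finsupp.prod_fintype _ _ (by simp)]
    simp only [map_one, one_mul, Finsupp.equivFunOnFinite_symm_apply_apply]
    rw [← Finset.prod_fiberwise_of_maps_to (g := f) (t := Finset.univ) (by simp)]
    refine Finset.prod_congr rfl fun j _ => ?_
    rw [Finset.prod_congr rfl (g := fun _ => MvPolynomial.X j), Finset.prod_const]
    intro i hi
    simp at hi
    rw [hi]
  have h2 : (∑ j, (MvPolynomial.X j : MvPolynomial ι ℤ)) ^ m =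
      ∑ k ∈ Finset.piAntidiag Finset.univ m, MvPolynomial.monomial
        (Finsupp.equivFunOnFinite.symm k) (Nat.multinomial Finset.univ k : ℤ) := by
    rw [Finset.sum_pow_eq_sum_piAntidiag]
    refine Finset.sum_congr rfl fun k _ => ?_
    rw [MvPolynomial.monomial_eq, Finsupp.prod_fintype _ _ (by simp)]
    simp
  have h3 := congrArg (MvPolynomial.coeff (Finsupp.equivFunOnFinite.symm c)) (h1.symm.trans h2)
  rw [MvPolynomial.coeff_sum, MvPolynomial.coeff_sum] at h3
  simp only [MvPolynomial.coeff_monomial, EmbeddingLike.apply_eq_iff_eq] at h3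
  rw [Finset.sum_ite_eq', if_pos (by simp [Finset.mem_piAntidiag, hc]), Finset.sum_boole] at h3
  exact_mod_cast h3

/-- Summation over functions, grouped by their fibre sizes. -/
theorem sum_fiberCount {ι : Type*} [Fintype ι] [DecidableEq ι] (m : ℕ) (φ : (ι → ℕ) → ℝ) :
    ∑ f : Fin m → ι, φ (fun j => (Finset.univ.filter fun i => f i = j).card) =
      ∑ c ∈ Finset.piAntidiag Finset.univ m, (Nat.multinomial Finset.univ c : ℝ) * φ c := by
  classical
  rw [← Finset.sum_fiberwise_of_maps_to (t := Finset.piAntidiag Finset.univ m)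
    (g := fun f : Fin m → ι => fun j => (Finset.univ.filter fun i => f i = j).card)]
  · refine Finset.sum_congr rfl fun c hc => ?_
    rw [Finset.mem_piAntidiag] at hc
    rw [← card_fiberCount_eq_multinomial hc.1, ← nsmul_eq_mul, ← Finset.sum_const]
    refine Finset.sum_congr rfl fun f hf => ?_
    rw [(Finset.mem_filter.1 hf).2]
  · intro f _
    simp only [Finset.mem_piAntidiag, Finset.mem_univ, implies_true, and_true]
    rw [← Finset.card_eq_sum_card_fiberwise (by simp)]
    simp

/-- `P` is a partition of `Fin n` into nonempty sets. -/
def IsSetPartition {n : ℕ} (P : Finset (Finset (Fin n))) : Prop :=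
  (∀ S ∈ P, S.Nonempty) ∧ ∀ v : Fin n, ∃! S, S ∈ P ∧ v ∈ S

/-- The fibre of `f` over `j`. -/
def fiberSet {n k : ℕ} (f : Fin n → Fin k) (j : Fin k) : Finset (Fin n) :=
  Finset.univ.filter fun i => f i = j

theorem mem_fiberSet {n k : ℕ} {f : Fin n → Fin k} {j : Fin k} {v : Fin n} :
    v ∈ fiberSet f j ↔ f v = j := by simp [fiberSet]

theorem fiberSet_injective {n k : ℕ} {f : Fin n → Fin k} (hf : f.Surjective) :
    Function.Injective (fiberSet f) := by
  intro i j h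
  obtain ⟨v, rfl⟩ := hf i
  have : v ∈ fiberSet f (f v) := mem_fiberSet.2 rfl
  rw [h] at this
  exact mem_fiberSet.1 this

theorem isSetPartition_image_fiberSet {n k : ℕ} {f : Fin n → Fin k} (hf : f.Surjective) :
    IsSetPartition (Finset.univ.image (fiberSet f)) := by
  refine ⟨?_, fun v => ⟨fiberSet f (f v), ⟨by simp, mem_fiberSet.2 rfl⟩, ?_⟩⟩
  · intro S hS
    obtain ⟨j, -, rfl⟩ := Finset.mem_image.1 hS
    obtain ⟨v, hv⟩ := hf j
    exact ⟨v, mem_fiberSet.2 hv⟩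
  · rintro S ⟨hS, hv⟩
    obtain ⟨j, -, rfl⟩ := Finset.mem_image.1 hS
    rw [mem_fiberSet.1 hv]

theorem card_surjective_image_fiberSet_eq {n k : ℕ} {P : Finset (Finset (Fin n))}
    (hP : IsSetPartition P) (hk : P.card = k) :
    (Finset.univ.filter fun f : Fin n → Fin k =>
      f.Surjective ∧ Finset.univ.image (fiberSet f) = P).card = k.factorial := by
  classical
  have hcard : Fintype.card (P ≃ Fin k) = k.factorial := by
    rw [Fintype.card_equiv (Fintype.equivFinOfCardEq (by simp [hk]))]
    simp [hk]
  rw [← hcard, ← Finset.card_univ]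
  symm
  choose part hpart hpart' using hP.2
  have huniq : ∀ (S : P) (v : Fin n), v ∈ S.1 → (⟨part v, (hpart v).1⟩ : P) = S :=
    fun S v hv => Subtype.ext (hpart' v S.1 ⟨S.2, hv⟩).symm
  have hfib : ∀ (e : P ≃ Fin k) (j : Fin k),
      fiberSet (fun v => e ⟨part v, (hpart v).1⟩) j = (e.symm j).1 := by
    intro e j
    ext v
    rw [mem_fiberSet]
    constructor
    · intro h
      rw [← h, Equiv.symm_apply_apply]
      exact (hpart v).2
    · intro h
      rw [huniq _ v h, Equiv.apply_symm_apply]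
  refine Finset.card_bij (fun e _ => fun v => e ⟨part v, (hpart v).1⟩) ?_ ?_ ?_
  · intro e _
    simp only [Finset.mem_filter, Finset.mem_univ, true_and]
    constructor
    · intro j
      obtain ⟨v, hv⟩ := hP.1 _ (e.symm j).2
      exact ⟨v, by simp only [huniq _ v hv, Equiv.apply_symm_apply]⟩
    · ext S
      simp only [Finset.mem_image, Finset.mem_univ, true_and, hfib]
      constructor
      · rintro ⟨j, rfl⟩
        exact (e.symm j).2
      · intro hS
        exact ⟨e ⟨S, hS⟩, by simp⟩
  · intro e _ e' _ h
    ext S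
    obtain ⟨v, hv⟩ := hP.1 _ S.2
    have := congrFun h v
    simp only [huniq S v hv] at this
    rw [this]
  · intro f hf
    simp only [Finset.mem_filter, Finset.mem_univ, true_and] at hf
    obtain ⟨hs, hi⟩ := hf
    have hmem : ∀ j, fiberSet f j ∈ P := fun j => hi ▸ Finset.mem_image_of_mem _ (Finset.mem_univ j)
    have hb : Function.Bijective (fun j => (⟨fiberSet f j, hmem j⟩ : P)) := by
      constructor
      · intro i j h
        exact fiberSet_injective hs (Subtype.ext_iff.1 h)
      · rintro ⟨S, hS⟩
        rw [← hi] at hS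
        obtain ⟨j, -, rfl⟩ := Finset.mem_image.1 hS
        exact ⟨j, rfl⟩
    refine ⟨(Equiv.ofBijective _ hb).symm, Finset.mem_univ _, ?_⟩
    funext v
    rw [Equiv.symm_apply_eq]
    exact huniq _ v (mem_fiberSet.2 rfl)

/-- Ordered and unordered partitions into `k` parts, weighted by part sizes. -/
theorem factorial_mul_sum_setPartition {n k : ℕ} (w : ℕ → ℝ) (hw : w 0 = 0) :
    open Classical in
    (k.factorial : ℝ) * ∑ P ∈ Finset.univ.filter
        (fun P : Finset (Finset (Fin n)) => IsSetPartition P ∧ P.card = k),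
        ∏ S ∈ P, w S.card =
      ∑ f : Fin n → Fin k, ∏ j, w (Finset.univ.filter fun i => f i = j).card := by
  classical
  have h0 : ∑ f : Fin n → Fin k, ∏ j, w (Finset.univ.filter fun i => f i = j).card =
      ∑ f ∈ Finset.univ.filter (fun f : Fin n → Fin k => f.Surjective),
        ∏ j, w (fiberSet f j).card := by
    symm
    refine Finset.sum_subset (Finset.filter_subset _ _) ?_
    intro f _ hf
    simp only [Finset.mem_filter, Finset.mem_univ, true_and] at hf
    unfold Function.Surjective at hf
    push Not at hf
    obtain ⟨j, hj⟩ := hf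
    refine Finset.prod_eq_zero (Finset.mem_univ j) ?_
    have : fiberSet f j = ∅ := by
      ext v
      simp [mem_fiberSet, hj v]
    rw [this, Finset.card_empty, hw]
  rw [h0, ← Finset.sum_fiberwise_of_maps_to
    (t := Finset.univ.filter (fun P : Finset (Finset (Fin n)) => IsSetPartition P ∧ P.card = k))
    (g := fun f : Fin n → Fin k => Finset.univ.image (fiberSet f)), Finset.mul_sum]
  · refine Finset.sum_congr rfl fun P hP => ?_
    simp only [Finset.mem_filter, Finset.mem_univ, true_and] at hP
    rw [← card_surjective_image_fiberSet_eq hP.1 hP.2, ← nsmul_eq_mul, ← Finset.sum_const,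
      Finset.filter_filter]
    refine Finset.sum_congr rfl fun f hf => ?_
    simp only [Finset.mem_filter, Finset.mem_univ, true_and] at hf
    rw [← hf.2, Finset.prod_image]
    intro i _ j _ h
    exact fiberSet_injective hf.1 h
  · intro f hf
    simp only [Finset.mem_filter, Finset.mem_univ, true_and] at hf ⊢
    refine ⟨isSetPartition_image_fiberSet hf, ?_⟩
    rw [Finset.card_image_of_injective _ (fiberSet_injective hf)]
    simp

/-- The number of subgraphs of `H`. -/
theorem card_subgraphs_eq_two_pow {V : Type*} [Fintype V] [DecidableEq V] (H : SimpleGraph V)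
    [DecidableRel H.Adj] :
    open Classical in
    (Finset.univ.filter fun G : SimpleGraph V => G ≤ H).card = 2 ^ H.edgeFinset.card := by
  classical
  rw [← Finset.card_powerset]
  refine Finset.card_bij (fun G _ => G.edgeFinset) ?_ ?_ ?_
  · intro G hG
    rw [Finset.mem_powerset]
    exact SimpleGraph.edgeFinset_subset_edgeFinset.2 (Finset.mem_filter.1 hG).2
  · intro G _ G' _ h
    exact SimpleGraph.edgeFinset_inj.1 h
  · intro s hs
    rw [Finset.mem_powerset] at hs
    have hs' : (s : Set (Sym2 V)) ⊆ H.edgeSet := by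
      intro e he
      exact SimpleGraph.mem_edgeFinset.1 (hs he)
    obtain ⟨G, hG⟩ : ∃ G : SimpleGraph V, G.edgeSet = s := by
      refine ⟨SimpleGraph.fromEdgeSet s, ?_⟩
      rw [SimpleGraph.edgeSet_fromEdgeSet, sdiff_eq_left, Set.disjoint_left]
      intro e he
      exact H.not_isDiag_of_mem_edgeSet (hs' he)
    refine ⟨G, ?_, Finset.coe_injective (G.coe_edgeFinset.trans hG)⟩
    simp only [Finset.mem_filter, Finset.mem_univ, true_and]
    rw [← SimpleGraph.edgeSet_subset_edgeSet, hG]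
    exact hs'

/-- The graph joining two vertices when no part of `P` contains both. -/
def crossGraph {n : ℕ} (P : Finset (Finset (Fin n))) : SimpleGraph (Fin n) where
  Adj u v := u ≠ v ∧ ∀ S ∈ P, ¬ (u ∈ S ∧ v ∈ S)
  symm := ⟨fun _ _ h => ⟨h.1.symm, fun S hS hc => h.2 S hS ⟨hc.2, hc.1⟩⟩⟩
  loopless := ⟨fun _ h => h.1 rfl⟩

theorem le_crossGraph_iff {n : ℕ} {P : Finset (Finset (Fin n))} {G : SimpleGraph (Fin n)} :
    G ≤ crossGraph P ↔ ∀ S ∈ P, ∀ u ∈ S, ∀ v ∈ S, ¬ G.Adj u v := by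
  constructor
  · intro h S hS u hu v hv huv
    exact (h huv).2 S hS ⟨hu, hv⟩
  · intro h u v huv
    exact ⟨huv.ne, fun S hS hc => h S hS u hc.1 v hc.2 huv⟩

theorem card_edgeFinset_crossGraph {n : ℕ} {P : Finset (Finset (Fin n))}
    (hP : IsSetPartition P) :
    open Classical in
    (crossGraph P).edgeFinset.card + ∑ S ∈ P, S.card.choose 2 = n.choose 2 := by
  classical
  have h1 : (P.biUnion fun S => S.offDiag.image Sym2.mk.uncurry).card =
      ∑ S ∈ P, S.card.choose 2 := by
    rw [Finset.card_biUnion]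
    · refine Finset.sum_congr rfl fun S _ => Sym2.card_image_offDiag S
    · intro S hS T hT hST
      rw [Function.onFun, Finset.disjoint_left]
      intro e heS heT
      obtain ⟨⟨a, b⟩, hab, rfl⟩ := Finset.mem_image.1 heS
      obtain ⟨⟨c, d⟩, hcd, h⟩ := Finset.mem_image.1 heT
      rw [Finset.mem_offDiag] at hab hcd
      apply hST
      have haT : a ∈ T := by
        simp only [Function.uncurry, Sym2.eq_iff] at h
        rcases h with ⟨rfl, rfl⟩ | ⟨rfl, rfl⟩
        · exact hcd.1
        · exact hcd.2.1
      exact (hP.2 a).unique ⟨hS, hab.1⟩ ⟨hT, haT⟩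
  have h2 : (⊤ : SimpleGraph (Fin n)).edgeFinset.card = n.choose 2 := by
    rw [SimpleGraph.card_edgeFinset_top_eq_card_choose_two, Fintype.card_fin]
  rw [← h2, ← h1, ← Finset.card_union_of_disjoint]
  · congr 1
    ext e
    induction e with
    | _ u v =>
      simp only [Finset.mem_union, SimpleGraph.mem_edgeFinset, SimpleGraph.mem_edgeSet,
        Finset.mem_biUnion, Finset.mem_image, Finset.mem_offDiag, Prod.exists, SimpleGraph.top_adj,
        Function.uncurry, Sym2.eq_iff]
      constructor
      · rintro (h | ⟨S, hS, a, b, hab, h⟩)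
        · exact h.1
        · rcases h with ⟨rfl, rfl⟩ | ⟨rfl, rfl⟩
          · exact hab.2.2
          · exact hab.2.2.symm
      · intro huv
        by_cases h : ∃ S ∈ P, u ∈ S ∧ v ∈ S
        · obtain ⟨S, hS, hu, hv⟩ := h
          exact Or.inr ⟨S, hS, u, v, ⟨hu, hv, huv⟩, Or.inl ⟨rfl, rfl⟩⟩
        · push Not at h
          exact Or.inl ⟨huv, fun S hS hc => h S hS hc.1 hc.2⟩
  · rw [Finset.disjoint_left]
    intro e he he'
    rw [Finset.mem_biUnion] at he'
    obtain ⟨S, hS, he'⟩ := he'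
    obtain ⟨⟨a, b⟩, hab, rfl⟩ := Finset.mem_image.1 he'
    rw [Finset.mem_offDiag] at hab
    rw [SimpleGraph.mem_edgeFinset] at he
    exact he.2 S hS ⟨hab.1, hab.2.1⟩

theorem gnpWeight_half {n : ℕ} (G : SimpleGraph (Fin n)) :
    gnpWeight n (1 / 2) G = (1 / 2) ^ n.choose 2 := by
  classical
  have h : edgeCount G ≤ n.choose 2 := by
    rw [edgeCount, Set.ncard_eq_toFinset_card']
    have := SimpleGraph.card_edgeFinset_le_card_choose_two (G := G)
    rw [Fintype.card_fin] at this
    exact this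
  rw [gnpWeight, show (1 : ℝ) - 1 / 2 = 1 / 2 by norm_num, ← pow_add, Nat.add_sub_cancel' h]

/-- The weight of a part of size `i` for `t`-bounded colourings. -/
noncomputable def partWeight (t i : ℕ) : ℝ :=
  if 1 ≤ i ∧ i ≤ t then (1 / 2) ^ i.choose 2 else 0

theorem EE_eq_sum_setPartition (n k t : ℕ) :
    open Classical in
    EE n k t = ∑ P ∈ Finset.univ.filter
        (fun P : Finset (Finset (Fin n)) => IsSetPartition P ∧ P.card = k),
        ∏ S ∈ P, partWeight t S.card := by
  classical
  have h1 : ∀ G : SimpleGraph (Fin n), (numPartitions k t G : ℝ) =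
      ∑ P ∈ Finset.univ.filter
        (fun P : Finset (Finset (Fin n)) => IsSetPartition P ∧ P.card = k),
        if (∀ S ∈ P, S.card ≤ t) ∧ G ≤ crossGraph P then 1 else 0 := by
    intro G
    rw [Finset.sum_boole, Finset.filter_filter, numPartitions, ← Set.ncard_coe_finset]
    congr 2
    ext P
    simp only [Set.mem_ofPred_eq, Finset.coe_filter, Finset.mem_univ, true_and,
      IsIndepPartition, IsSetPartition, le_crossGraph_iff]
    constructor
    · rintro ⟨hk, h, h'⟩
      exact ⟨⟨⟨fun S hS => (h S hS).1, h'⟩, hk⟩, fun S hS => (h S hS).2.1,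
        fun S hS => (h S hS).2.2⟩
    · rintro ⟨⟨⟨h, h'⟩, hk⟩, h2, h3⟩
      exact ⟨hk, fun S hS => ⟨h S hS, h2 S hS, h3 S hS⟩, h'⟩
  unfold EE
  simp only [gnpWeight_half, h1, Finset.mul_sum]
  rw [Finset.sum_comm]
  refine Finset.sum_congr rfl fun P hP => ?_
  simp only [Finset.mem_filter, Finset.mem_univ, true_and] at hP
  by_cases ht : ∀ S ∈ P, S.card ≤ t
  · simp only [eq_true ht, true_and]
    rw [← Finset.mul_sum, Finset.sum_boole, card_subgraphs_eq_two_pow,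
      Finset.prod_congr rfl (g := fun S => (1 / 2 : ℝ) ^ S.card.choose 2),
      Finset.prod_pow_eq_pow_sum, ← card_edgeFinset_crossGraph hP.1, pow_add]
    · push_cast
      rw [mul_right_comm, ← mul_pow]
      norm_num
    · intro S hS
      rw [partWeight, if_pos ⟨(hP.1.1 S hS).card_pos, ht S hS⟩]
  · simp only [eq_false ht, false_and, if_false, mul_zero, Finset.sum_const_zero]
    push Not at ht
    obtain ⟨S, hS, h⟩ := ht
    symm
    refine Finset.prod_eq_zero hS ?_
    rw [partWeight, if_neg]
    omega

/-- The profiles `c` (with `c i` parts of size `i + 1`) of partitions of an `n`-set into `k`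
parts of size at most `t`. -/
def profiles (n k t : ℕ) : Finset (Fin t → ℕ) :=
  (Finset.piAntidiag Finset.univ k).filter fun c => ∑ i, (i.1 + 1) * c i = n

theorem mem_profiles {n k t : ℕ} {c : Fin t → ℕ} :
    c ∈ profiles n k t ↔ ∑ i, c i = k ∧ ∑ i, (i.1 + 1) * c i = n := by
  simp [profiles, Finset.mem_piAntidiag]

theorem dI_pos (i : ℕ) : 0 < dI i := by unfold dI; positivity

theorem multinomial_mul_prod_factorial {ι : Type*} [Fintype ι] {m : ℕ} {c : ι → ℕ}
    (hc : ∑ i, c i = m) :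
    (Nat.multinomial Finset.univ c : ℝ) * ∏ i, ((c i).factorial : ℝ) = m.factorial := by
  have := Nat.multinomial_spec Finset.univ c
  rw [hc] at this
  rw [mul_comm, ← this]
  push_cast
  rfl

theorem EE_eq_sum_profiles (n k t : ℕ) :
    EE n k t = n.factorial * ∑ c ∈ profiles n k t,
      ∏ i, (((c i).factorial : ℝ) * dI (i.1 + 1) ^ c i)⁻¹ := by
  classical
  have hk0 : (k.factorial : ℝ) ≠ 0 := by positivity
  have hw : partWeight t 0 = 0 := by simp [partWeight]
  have h1 := factorial_mul_sum_setPartition (n := n) (k := k) (partWeight t) hw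
  rw [← EE_eq_sum_setPartition,
    sum_fiberCount n fun a : Fin k → ℕ => ∏ j, partWeight t (a j)] at h1
  have h2 : ∑ a ∈ Finset.piAntidiag (Finset.univ : Finset (Fin k)) n,
      (Nat.multinomial Finset.univ a : ℝ) * ∏ j, partWeight t (a j) =
      ∑ g : Fin k → Fin t, if ∑ j, ((g j).1 + 1) = n then
        (n.factorial : ℝ) * ∏ j, (dI ((g j).1 + 1))⁻¹ else 0 := by
    rw [← Finset.sum_filter]
    symm
    rw [← Finset.sum_filter_add_sum_filter_not (Finset.piAntidiag Finset.univ n)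
      (fun a => ∀ j, 1 ≤ a j ∧ a j ≤ t)]
    rw [Finset.sum_eq_zero (s := (Finset.piAntidiag Finset.univ n).filter
      (fun a => ¬ ∀ j, 1 ≤ a j ∧ a j ≤ t)), add_zero]
    · refine Finset.sum_bij (fun g _ => fun j => (g j).1 + 1) ?_ ?_ ?_ ?_
      · intro g hg
        simp only [Finset.mem_filter, Finset.mem_univ, true_and] at hg
        simp only [Finset.mem_filter, Finset.mem_piAntidiag, Finset.mem_univ, implies_true,
          and_true, hg, true_and]
        intro j
        have := (g j).2
        omega
      · intro g _ g' _ h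
        funext j
        have := congrFun h j
        ext
        simpa using this
      · intro a ha
        simp only [Finset.mem_filter, Finset.mem_piAntidiag, Finset.mem_univ, implies_true,
          and_true] at ha
        have hsucc : ∀ j, a j - 1 + 1 = a j := fun j => by have := ha.2 j; omega
        refine ⟨fun j => ⟨a j - 1, by have := ha.2 j; omega⟩, ?_, ?_⟩
        · simp only [Finset.mem_filter, Finset.mem_univ, true_and, hsucc]
          exact ha.1
        · funext j
          exact hsucc j
      · intro g hg
        simp only [Finset.mem_filter, Finset.mem_univ, true_and] at hg
        rw [← multinomial_mul_prod_factorial hg, mul_assoc, ← Finset.prod_mul_distrib]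
        congr 1
        refine Finset.prod_congr rfl fun j _ => ?_
        rw [partWeight, if_pos ⟨Nat.succ_pos _, (g j).2⟩, dI, one_div, inv_pow]
        field_simp
    · intro a ha
      simp only [Finset.mem_filter] at ha
      have h := ha.2
      push Not at h
      obtain ⟨j, hj⟩ := h
      rw [Finset.prod_eq_zero (Finset.mem_univ j), mul_zero]
      rw [partWeight, if_neg]
      omega
  have h3 : ∀ g : Fin k → Fin t, (if ∑ j, ((g j).1 + 1) = n then
        (n.factorial : ℝ) * ∏ j, (dI ((g j).1 + 1))⁻¹ else 0) =
      (fun c : Fin t → ℕ => if ∑ i, (i.1 + 1) * c i = n then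
        (n.factorial : ℝ) * ∏ i, (dI (i.1 + 1))⁻¹ ^ c i else 0)
        (fun i => (Finset.univ.filter fun j => g j = i).card) := by
    intro g
    have ha : ∑ j, ((g j).1 + 1) =
        ∑ i : Fin t, (i.1 + 1) * (Finset.univ.filter fun j => g j = i).card := by
      rw [← Finset.sum_fiberwise_of_maps_to (g := g) (t := Finset.univ) (by simp)]
      refine Finset.sum_congr rfl fun i _ => ?_
      rw [Finset.sum_congr rfl (g := fun _ => i.1 + 1)]
      · rw [Finset.sum_const, smul_eq_mul, mul_comm]
      · intro j hj
        rw [(Finset.mem_filter.1 hj).2]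
    have hb : ∏ j, (dI ((g j).1 + 1))⁻¹ =
        ∏ i : Fin t, (dI (i.1 + 1))⁻¹ ^ (Finset.univ.filter fun j => g j = i).card := by
      rw [← Finset.prod_fiberwise_of_maps_to (g := g) (t := Finset.univ) (by simp)]
      refine Finset.prod_congr rfl fun i _ => ?_
      rw [Finset.prod_congr rfl (g := fun _ => (dI (i.1 + 1))⁻¹), Finset.prod_const]
      intro j hj
      rw [(Finset.mem_filter.1 hj).2]
    simp only [ha, hb]
  rw [h2, Finset.sum_congr rfl (fun g _ => h3 g),
    sum_fiberCount k (fun c : Fin t → ℕ => if ∑ i, (i.1 + 1) * c i = n then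
        (n.factorial : ℝ) * ∏ i, (dI (i.1 + 1))⁻¹ ^ c i else 0)] at h1
  apply mul_left_cancel₀ hk0
  rw [h1, profiles, Finset.sum_filter, Finset.mul_sum, Finset.mul_sum]
  refine Finset.sum_congr rfl fun c hc => ?_
  rw [Finset.mem_piAntidiag] at hc
  split_ifs
  · rw [← multinomial_mul_prod_factorial hc.1]
    simp only [mul_inv, Finset.prod_mul_distrib, Finset.prod_inv_distrib, inv_pow]
    have : ∏ i, ((c i).factorial : ℝ) ≠ 0 := by positivity
    field_simp
  · simp

theorem log_dI (i : ℕ) : log (dI i) = i.choose 2 * log 2 + log i.factorial := by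
  rw [dI, log_mul (by positivity) (by positivity), log_pow]

theorem one_le_dI (i : ℕ) : 1 ≤ dI i := by
  unfold dI
  have h1 : (1 : ℝ) ≤ 2 ^ i.choose 2 := one_le_pow₀ (by norm_num)
  have h2 : (1 : ℝ) ≤ i.factorial := by exact_mod_cast i.factorial_pos
  exact one_le_mul_of_one_le_of_one_le h1 h2

/-- An approximation of the slope of `log ∘ dI` at `m`. -/
noncomputable def dSlope (m : ℕ) : ℝ := (m - 1 / 2) * log 2 + log m

theorem log_factorial_tangent_le {m : ℕ} (hm : 1 ≤ m) (i : ℕ) :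
    log m.factorial + ((i : ℝ) - m) * log m ≤ log i.factorial := by
  have hm0 : (0 : ℝ) < m := by exact_mod_cast hm
  rcases le_total m i with h | h
  · have h1 := Nat.factorial_mul_pow_sub_le_factorial h
    have h2 : (m.factorial : ℝ) * (m : ℝ) ^ (i - m) ≤ i.factorial := by exact_mod_cast h1
    have h3 := log_le_log (by positivity) h2
    rw [log_mul (by positivity) (by positivity), log_pow, Nat.cast_sub h] at h3
    exact h3
  · have h1 : m.factorial ≤ i.factorial * m ^ (m - i) := by
      rw [← Nat.factorial_mul_descFactorial (Nat.sub_le m i), Nat.sub_sub_self h]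
      exact Nat.mul_le_mul_left _ (Nat.descFactorial_le_pow m (m - i))
    have h2 : (m.factorial : ℝ) ≤ i.factorial * (m : ℝ) ^ (m - i) := by exact_mod_cast h1
    have h3 := log_le_log (by positivity) h2
    rw [log_mul (by positivity) (by positivity), log_pow, Nat.cast_sub h] at h3
    linarith

theorem log_dI_tangent_le {m : ℕ} (hm : 1 ≤ m) (i : ℕ) :
    log (dI m) + ((i : ℝ) - m) * dSlope m + log 2 / 2 * ((i : ℝ) - m) ^ 2 ≤ log (dI i) := by
  have h := log_factorial_tangent_le hm i
  rw [log_dI, log_dI, Nat.cast_choose_two, Nat.cast_choose_two, dSlope]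
  nlinarith

theorem log_dI_le_tangent {m i : ℕ} (hm : 1 ≤ m) (hi : 1 ≤ i) :
    log (dI i) ≤ log (dI m) + ((i : ℝ) - m) * dSlope m + 2 * ((i : ℝ) - m) ^ 2 := by
  have h := log_dI_tangent_le hi m
  have hm1 : (1 : ℝ) ≤ m := by exact_mod_cast hm
  have hi1 : (1 : ℝ) ≤ i := by exact_mod_cast hi
  have key : ∀ a b : ℝ, 1 ≤ a → a ≤ b → (b - a) * (log b - log a) ≤ (b - a) ^ 2 := by
    intro a b ha hab
    have h1 : log b - log a ≤ b - a := by
      have ha0 : 0 < a := by linarith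
      have hb0 : 0 < b := by linarith
      rw [← log_div hb0.ne' ha0.ne']
      refine (log_le_sub_one_of_pos (by positivity)).trans ?_
      rw [div_sub_one (by linarith), div_le_iff₀ (by linarith)]
      nlinarith
    nlinarith
  have h2 : ((i : ℝ) - m) * (log i - log m) ≤ ((i : ℝ) - m) ^ 2 := by
    rcases le_total (m : ℝ) i with h | h
    · exact key _ _ hm1 h
    · have := key _ _ hi1 h
      nlinarith
  have h3 : log 2 ≤ 1 := by linarith [log_two_lt_d9]
  have h4 : ((i : ℝ) - m) * dSlope i = ((i : ℝ) - m) * dSlope m + ((i : ℝ) - m) ^ 2 * log 2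
      + ((i : ℝ) - m) * (log i - log m) := by
    unfold dSlope; ring
  nlinarith [sq_nonneg ((i : ℝ) - m)]

theorem exists_sum_gaussian_le :
    ∃ C : ℝ, ∀ t m : ℕ, ∑ i : Fin t, exp (-(log 2 / 2 * (((i.1 + 1 : ℕ) : ℝ) - m) ^ 2)) ≤ C := by
  have hl : 0 < log 2 / 2 := by have := log_pos one_lt_two; linarith
  have h1 : Summable fun n : ℕ => exp (-(log 2 / 2 * (n : ℝ) ^ 2)) := by
    refine Summable.of_nonneg_of_le (fun _ => (exp_pos _).le) (fun n => ?_)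
      (Real.summable_exp_nat_mul_iff.2 (neg_neg_of_pos hl))
    rw [exp_le_exp]
    have : (n : ℝ) ≤ (n : ℝ) ^ 2 := by
      exact_mod_cast Nat.le_self_pow two_ne_zero n
    nlinarith
  have h2 : Summable fun z : ℤ => exp (-(log 2 / 2 * (z : ℝ) ^ 2)) := by
    refine Summable.of_nat_of_neg ?_ ?_
    · simpa using h1
    · simpa using h1
  refine ⟨∑' z : ℤ, exp (-(log 2 / 2 * (z : ℝ) ^ 2)), fun t m => ?_⟩
  have hinj : Function.Injective fun i : Fin t => ((i.1 + 1 : ℕ) : ℤ) - m := by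
    intro i j h
    ext
    simp only at h
    omega
  have h3 := h2.sum_le_tsum (Finset.univ.image fun i : Fin t => ((i.1 + 1 : ℕ) : ℤ) - m)
    (fun _ _ => (exp_pos _).le)
  rw [Finset.sum_image hinj.injOn] at h3
  refine le_trans (le_of_eq ?_) h3
  refine Finset.sum_congr rfl fun i _ => ?_
  push_cast
  rfl

/-- The `p`-dependent part of `Ltilde`. -/
noncomputable def partEntropy {t : ℕ} (q : Fin t → ℝ) : ℝ :=
  -∑ i, q i * log (q i * dI (i.1 + 1))

theorem mul_log_mul_eq {x d : ℝ} (hd : 0 < d) : x * log (x * d) = x * log x + x * log d := by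
  rcases eq_or_ne x 0 with rfl | hx
  · simp
  · rw [log_mul hx hd.ne']
    ring

theorem partEntropy_eq {t : ℕ} (q : Fin t → ℝ) :
    partEntropy q = ∑ i, (negMulLog (q i) - q i * log (dI (i.1 + 1))) := by
  rw [partEntropy, ← Finset.sum_neg_distrib]
  refine Finset.sum_congr rfl fun i _ => ?_
  rw [mul_log_mul_eq (dI_pos _), negMulLog]
  ring

theorem exists_partEntropy_le :
    ∃ C : ℝ, ∀ (t m : ℕ) (ρ : ℝ) (q : Fin t → ℝ), 1 ≤ m → q ∈ Ptilde ρ t →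
      partEntropy q ≤ -log (dI m) - dSlope m * (ρ - m) + C := by
  obtain ⟨C, hC⟩ := exists_sum_gaussian_le
  refine ⟨C, fun t m ρ q hm hq => ?_⟩
  obtain ⟨h01, hsum, hmean⟩ := hq
  have h1 : ∀ i : Fin t, negMulLog (q i) - q i * log (dI (i.1 + 1)) ≤
      q i * (-log (dI m)) - dSlope m * (((i.1 + 1 : ℕ) : ℝ) * q i - q i * m) +
        (exp (-(log 2 / 2 * (((i.1 + 1 : ℕ) : ℝ) - m) ^ 2)) - q i) := by
    intro i
    have ht := log_dI_tangent_le hm (i.1 + 1)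
    set s : ℝ := ((i.1 + 1 : ℕ) : ℝ) - m with hs
    have hq0 := (h01 i).1
    have h2 := mul_le_mul_of_nonneg_left ht hq0
    have h3 : negMulLog (q i) - q i * (log 2 / 2 * s ^ 2) ≤
        exp (-(log 2 / 2 * s ^ 2)) - q i := by
      rcases hq0.eq_or_lt with h | h
      · rw [← h]
        simp [(exp_pos _).le]
      · have h4 : log (exp (-(log 2 / 2 * s ^ 2)) / q i) ≤
            exp (-(log 2 / 2 * s ^ 2)) / q i - 1 := log_le_sub_one_of_pos (by positivity)
        rw [log_div (exp_pos _).ne' h.ne', log_exp] at h4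
        have h5 := mul_le_mul_of_nonneg_left h4 h.le
        rw [mul_sub, mul_sub, mul_div_cancel₀ _ h.ne'] at h5
        rw [negMulLog]
        linarith
    have hid : ((i.1 + 1 : ℕ) : ℝ) * q i - q i * m = q i * s := by rw [hs]; ring
    rw [hid]
    nlinarith
  have h2 := Finset.sum_le_sum fun i (_ : i ∈ Finset.univ) => h1 i
  rw [← partEntropy_eq, Finset.sum_add_distrib, Finset.sum_sub_distrib, Finset.sum_sub_distrib,
    ← Finset.sum_mul, ← Finset.mul_sum, Finset.sum_sub_distrib, ← Finset.sum_mul, hsum, hmean]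
    at h2
  have := hC t m
  linarith

/-- The supremum of `partEntropy` over `Ptilde ρ t`. -/
noncomputable def maxEntropy (t : ℕ) (ρ : ℝ) : ℝ := sSup (partEntropy '' Ptilde ρ t)

theorem bddAbove_partEntropy (t : ℕ) (ρ : ℝ) : BddAbove (partEntropy '' Ptilde ρ t) := by
  obtain ⟨C, hC⟩ := exists_partEntropy_le
  refine ⟨-log (dI 1) - dSlope 1 * (ρ - (1 : ℕ)) + C, ?_⟩
  rintro _ ⟨q, hq, rfl⟩
  exact hC t 1 ρ q le_rfl hq

theorem partEntropy_le_maxEntropy {t : ℕ} {ρ : ℝ} {q : Fin t → ℝ} (hq : q ∈ Ptilde ρ t) :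
    partEntropy q ≤ maxEntropy t ρ :=
  le_csSup (bddAbove_partEntropy t ρ) ⟨q, hq, rfl⟩

theorem Ptilde_combination {t : ℕ} {ρ ρ' a b : ℝ} {q q' : Fin t → ℝ} (hq : q ∈ Ptilde ρ t)
    (hq' : q' ∈ Ptilde ρ' t) (ha : 0 ≤ a) (hb : 0 ≤ b) (hab : a + b = 1) :
    a • q + b • q' ∈ Ptilde (a * ρ + b * ρ') t := by
  obtain ⟨h1, h2, h3⟩ := hq
  obtain ⟨h1', h2', h3'⟩ := hq'
  refine ⟨fun i => (convex_Icc (0 : ℝ) 1) (h1 i) (h1' i) ha hb hab, ?_, ?_⟩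
  · simp only [Pi.add_apply, Pi.smul_apply, smul_eq_mul, Finset.sum_add_distrib,
      ← Finset.mul_sum, h2, h2']
    linarith
  · simp only [Pi.add_apply, Pi.smul_apply, smul_eq_mul, mul_add, Finset.sum_add_distrib,
      mul_left_comm _ a, mul_left_comm _ b, ← Finset.mul_sum, h3, h3']

theorem single_mem_Ptilde {t : ℕ} (i : Fin t) :
    Pi.single i 1 ∈ Ptilde ((i.1 + 1 : ℕ) : ℝ) t := by
  classical
  refine ⟨fun j => ?_, by simp, ?_⟩
  · rcases eq_or_ne j i with rfl | h
    · simp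
    · simp [h]
  · simp [Pi.single_apply]

theorem partEntropy_single {t : ℕ} (i : Fin t) :
    partEntropy (Pi.single i 1) = -log (dI (i.1 + 1)) := by
  classical
  rw [partEntropy, Finset.sum_eq_single i]
  · simp
  · intro j _ h
    simp [h]
  · simp

theorem Ptilde_nonempty {t : ℕ} {ρ : ℝ} (hρ : ρ ∈ Set.Icc (1 : ℝ) t) : (Ptilde ρ t).Nonempty := by
  have ht : 1 ≤ t := by exact_mod_cast hρ.1.trans hρ.2
  have h1 := single_mem_Ptilde (⟨0, ht⟩ : Fin t)
  have h2 := single_mem_Ptilde (⟨t - 1, by omega⟩ : Fin t)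
  simp only [Nat.sub_add_cancel ht, zero_add, Nat.cast_one] at h1 h2
  rw [← segment_eq_Icc (by exact_mod_cast ht)] at hρ
  obtain ⟨a, b, ha, hb, hab, rfl⟩ := hρ
  exact ⟨_, Ptilde_combination h1 h2 ha hb hab⟩

theorem le_partEntropy_combination {t : ℕ} {ρ ρ' a b : ℝ} {q q' : Fin t → ℝ}
    (hq : q ∈ Ptilde ρ t) (hq' : q' ∈ Ptilde ρ' t) (ha : 0 ≤ a) (hb : 0 ≤ b) (hab : a + b = 1) :
    a * partEntropy q + b * partEntropy q' ≤ partEntropy (a • q + b • q') := by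
  simp only [partEntropy_eq, Finset.mul_sum, ← Finset.sum_add_distrib]
  refine Finset.sum_le_sum fun i _ => ?_
  have := concaveOn_negMulLog.2 (hq.1 i).1 (hq'.1 i).1 ha hb hab
  simp only [Pi.add_apply, Pi.smul_apply, smul_eq_mul] at this ⊢
  linarith

theorem concaveOn_maxEntropy (t : ℕ) : ConcaveOn ℝ (Set.Icc (1 : ℝ) t) (maxEntropy t) := by
  refine ⟨convex_Icc _ _, fun ρ hρ ρ' hρ' a b ha hb hab => ?_⟩
  refine le_of_forall_pos_le_add fun δ hδ => ?_
  obtain ⟨_, ⟨q, hq, rfl⟩, h⟩ := exists_lt_of_lt_csSup ((Ptilde_nonempty hρ).image partEntropy)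
    (sub_lt_self (maxEntropy t ρ) hδ)
  obtain ⟨_, ⟨q', hq', rfl⟩, h'⟩ := exists_lt_of_lt_csSup ((Ptilde_nonempty hρ').image partEntropy)
    (sub_lt_self (maxEntropy t ρ') hδ)
  have h1 := partEntropy_le_maxEntropy (Ptilde_combination hq hq' ha hb hab)
  have h2 := le_partEntropy_combination hq hq' ha hb hab
  simp only [smul_eq_mul]
  have h3 := mul_le_mul_of_nonneg_left h.le ha
  have h4 := mul_le_mul_of_nonneg_left h'.le hb
  have h5 : a * δ + b * δ = δ := by rw [← add_mul, hab, one_mul]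
  linarith

theorem le_maxEntropy {t m : ℕ} {ρ R : ℝ} (hm : 1 ≤ m) (h1 : 1 ≤ ρ) (ht : ρ < t)
    (hR : |ρ - m| ≤ R) :
    -log (dI m) - dSlope m * (ρ - m) - 2 * (R + 1) ^ 2 ≤ maxEntropy t ρ := by
  set i := ⌊ρ⌋₊ with hi
  have hi0 : (i : ℝ) ≤ ρ := Nat.floor_le (by linarith)
  have hi1 : ρ < i + 1 := Nat.lt_floor_add_one ρ
  have hi2 : 1 ≤ i := Nat.le_floor (by exact_mod_cast h1)
  have hit : i + 1 ≤ t := by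
    have : (i : ℝ) < t := hi0.trans_lt ht
    exact_mod_cast this
  obtain ⟨hR1, hR2⟩ := abs_le.1 hR
  have hpt : ∀ j : ℕ, 1 ≤ j → j ≤ t → |(j : ℝ) - m| ≤ R + 1 →
      -log (dI m) - dSlope m * (j - m) - 2 * (R + 1) ^ 2 ≤ maxEntropy t j := by
    intro j hj hjt hjR
    have h2 := partEntropy_le_maxEntropy (single_mem_Ptilde (⟨j - 1, by omega⟩ : Fin t))
    rw [partEntropy_single] at h2
    simp only [Nat.sub_add_cancel hj] at h2
    have h3 := log_dI_le_tangent hm hj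
    have h4 : ((j : ℝ) - m) ^ 2 ≤ (R + 1) ^ 2 := sq_le_sq.2 (hjR.trans (le_abs_self _))
    linarith
  have ha := hpt i hi2 (by omega) (abs_le.2 ⟨by linarith, by linarith⟩)
  have hb := hpt (i + 1) (by omega) hit (abs_le.2 ⟨by push_cast; linarith, by push_cast; linarith⟩)
  have hmi : (i : ℝ) ∈ Set.Icc (1 : ℝ) t :=
    ⟨by exact_mod_cast hi2, by exact_mod_cast (by omega : i ≤ t)⟩
  have hmi' : ((i + 1 : ℕ) : ℝ) ∈ Set.Icc (1 : ℝ) t :=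
    ⟨by exact_mod_cast (by omega : 1 ≤ i + 1), by exact_mod_cast hit⟩
  have hc := (concaveOn_maxEntropy t).2 hmi hmi'
    (show 0 ≤ 1 - (ρ - i) by linarith) (show 0 ≤ ρ - i by linarith) (by ring)
  have he : (1 - (ρ - i)) • (i : ℝ) + (ρ - i) • ((i + 1 : ℕ) : ℝ) = ρ := by
    push_cast
    simp only [smul_eq_mul]
    ring
  rw [he] at hc
  simp only [smul_eq_mul] at hc
  have h3 := mul_le_mul_of_nonneg_left ha (show 0 ≤ 1 - (ρ - i) by linarith)
  have h4 := mul_le_mul_of_nonneg_left hb (show 0 ≤ ρ - i by linarith)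
  push_cast at h3 h4 hc
  refine le_trans (le_of_eq ?_) ((add_le_add h3 h4).trans hc)
  ring

/-- `Lhat0` as a function of the average part size `ρ`. -/
noncomputable def logRate (n : ℝ) (t : ℕ) (ρ : ℝ) : ℝ :=
  (ρ - 1) * log n + log ρ - ρ + 1 + maxEntropy t ρ

theorem Ltilde_eq {n ρ : ℝ} (hn : 0 < n) (hρ : 0 < ρ) {t : ℕ} (q : Fin t → ℝ) :
    Ltilde ρ (n / ρ) q = ((ρ - 1) * log n + log ρ - ρ + 1) + partEntropy q := by
  rw [Ltilde, mul_div_cancel₀ _ hρ.ne', log_div hn.ne' hρ.ne', partEntropy]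
  ring

theorem Lhat0_eq_logRate {n k : ℝ} (hn : 0 < n) (hk : 0 < k) {t : ℕ} (h1 : 1 ≤ n / k)
    (ht : n / k ≤ t) : Lhat0 n k t = logRate n t (n / k) := by
  have hk' : k = n / (n / k) := by field_simp
  rw [Lhat0, Ltilde0, logRate, maxEntropy]
  set ρ := n / k with hρ
  have hset : {L : ℝ | ∃ q ∈ Ptilde ρ t, L = Ltilde ρ k q} =
      (OrderIso.addLeft ((ρ - 1) * log n + log ρ - ρ + 1)) '' (partEntropy '' Ptilde ρ t) := by
    ext L
    simp only [Set.mem_ofPred_eq, Set.mem_image, exists_exists_and_eq_and, OrderIso.addLeft_apply]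
    refine exists_congr fun q => and_congr_right fun _ => ?_
    rw [hk', Ltilde_eq hn (by linarith), eq_comm]
  rw [hset, ← OrderIso.map_csSup' _ ((Ptilde_nonempty ⟨h1, ht⟩).image _)
    (bddAbove_partEntropy t ρ), OrderIso.addLeft_apply]

theorem concaveOn_logRate (n : ℝ) (t : ℕ) : ConcaveOn ℝ (Set.Icc (1 : ℝ) t) (logRate n t) := by
  have h1 : ConcaveOn ℝ (Set.Icc (1 : ℝ) t) log :=
    strictConcaveOn_log_Ioi.concaveOn.subset (fun x hx => by
      have := hx.1
      simp only [Set.mem_Ioi]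
      linarith) (convex_Icc _ _)
  have h2 := h1.add (concaveOn_maxEntropy t)
  refine ⟨convex_Icc _ _, fun x hx y hy a b ha hb hab => ?_⟩
  have h3 := h2.2 hx hy ha hb hab
  have hb' : b = 1 - a := by linarith
  simp only [logRate, smul_eq_mul, Pi.add_apply] at h3 ⊢
  refine le_trans (le_of_eq ?_) (add_le_add_left h3
    ((a * x + b * y - 1) * log n - (a * x + b * y) + 1)) |>.trans (le_of_eq ?_)
  · rw [hb']; ring
  · ring

theorem mul_log_sub_le_log_factorial (m : ℕ) : m * log m - m ≤ log m.factorial := by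
  rcases Nat.eq_zero_or_pos m with rfl | hm
  · simp
  have hm0 : (0 : ℝ) < m := by exact_mod_cast hm
  have h := pow_div_factorial_le_exp (m : ℝ) hm0.le m
  have h1 := log_le_log (by positivity) h
  rw [log_exp, log_div (by positivity) (by positivity), log_pow] at h1
  linarith

theorem log_factorial_le {m : ℕ} (hm : 1 ≤ m) :
    log m.factorial ≤ m * log m - m + 1 + log m := by
  induction m, hm using Nat.le_induction with
  | base => simp
  | succ m hm ih =>
    have hm0 : (0 : ℝ) < m := by exact_mod_cast hm
    rw [Nat.factorial_succ]
    push_cast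
    rw [log_mul (by positivity) (by positivity)]
    have h := one_sub_inv_le_log_of_pos (show (0 : ℝ) < (m + 1) / m by positivity)
    rw [log_div (by positivity) (by positivity), inv_div] at h
    have h2 : ((m : ℝ) + 1) * (1 - m / (m + 1)) = 1 := by field_simp; ring
    have h3 := mul_le_mul_of_nonneg_left h (show (0 : ℝ) ≤ m + 1 by positivity)
    rw [h2] at h3
    nlinarith

theorem log_factorial_floor_le {x : ℝ} (hx : 0 ≤ x) :
    log (⌊x⌋₊.factorial) ≤ x * log x - x + 2 + log (x + 1) := by
  have hl : 0 ≤ log (x + 1) := log_nonneg (by linarith)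
  rcases Nat.eq_zero_or_pos ⌊x⌋₊ with h | h
  · rw [h]
    simp only [Nat.factorial_zero, Nat.cast_one, log_one]
    rcases hx.eq_or_lt with rfl | hx0
    · simp
    · have h1 := mul_le_mul_of_nonneg_left (one_sub_inv_le_log_of_pos hx0) hx
      rw [mul_sub, mul_inv_cancel₀ hx0.ne'] at h1
      linarith
  · have h1 := log_factorial_le h
    have hm : (1 : ℝ) ≤ (⌊x⌋₊ : ℝ) := by exact_mod_cast h
    have hmx : (⌊x⌋₊ : ℝ) ≤ x := Nat.floor_le hx
    set m : ℝ := (⌊x⌋₊ : ℝ)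
    have hx0 : 0 < x := by linarith
    have h2 := one_sub_inv_le_log_of_pos (show 0 < x / m by positivity)
    rw [log_div (by positivity) (by positivity), inv_div] at h2
    have h3 := mul_le_mul_of_nonneg_left h2 hx
    have h4 : x * (1 - m / x) = x - m := by field_simp
    rw [h4] at h3
    have h5 : 0 ≤ (x - m) * log m := mul_nonneg (by linarith) (log_nonneg hm)
    have h6 : log m ≤ log (x + 1) := log_le_log (by linarith) (by linarith)
    nlinarith

theorem sum_scaled_eq {t : ℕ} {q : Fin t → ℝ} {k : ℝ} (hk : 0 < k) (hq : ∑ i, q i = 1) :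
    ∑ i, (k * q i * log (k * q i) - k * q i + k * q i * log (dI (i.1 + 1))) =
      k * log k - k - k * partEntropy q := by
  have h : ∀ i : Fin t, k * q i * log (k * q i) - k * q i + k * q i * log (dI (i.1 + 1)) =
      (k * log k - k) * q i - k * (negMulLog (q i) - q i * log (dI (i.1 + 1))) := by
    intro i
    have h1 := mul_log_mul_eq (x := q i) hk
    rw [mul_comm (q i) k] at h1
    rw [mul_assoc k, h1, negMulLog]
    ring
  rw [Finset.sum_congr rfl fun i _ => h i, Finset.sum_sub_distrib, ← Finset.mul_sum,
    ← Finset.mul_sum, hq, partEntropy_eq, mul_one]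

theorem log_prod_inv {t : ℕ} (c : Fin t → ℕ) :
    log (∏ i, (((c i).factorial : ℝ) * dI (i.1 + 1) ^ c i)⁻¹) =
      -∑ i, (log (c i).factorial + c i * log (dI (i.1 + 1))) := by
  have hp : ∀ i : Fin t, 0 < ((c i).factorial : ℝ) * dI (i.1 + 1) ^ c i := fun i =>
    mul_pos (by positivity) (pow_pos (dI_pos _) _)
  rw [log_prod fun i _ => (inv_pos.2 (hp i)).ne', ← Finset.sum_neg_distrib]
  refine Finset.sum_congr rfl fun i _ => ?_
  rw [log_inv, log_mul (by positivity) (pow_pos (dI_pos _) _).ne', log_pow]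

theorem profile_term_pos {t : ℕ} (c : Fin t → ℕ) :
    0 < ∏ i, (((c i).factorial : ℝ) * dI (i.1 + 1) ^ c i)⁻¹ :=
  Finset.prod_pos fun i _ => inv_pos.2 (mul_pos (by positivity) (pow_pos (dI_pos _) _))

theorem profile_bounds {n k t : ℕ} {c : Fin t → ℕ} (hc : c ∈ profiles n k t) :
    k ≤ n ∧ n ≤ t * k := by
  obtain ⟨h1, h2⟩ := mem_profiles.1 hc
  rw [← h1, ← h2, Finset.mul_sum]
  exact ⟨Finset.sum_le_sum fun i _ => Nat.le_mul_of_pos_left _ (Nat.succ_pos _),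
    Finset.sum_le_sum fun i _ => Nat.mul_le_mul_right _ i.2⟩

theorem mul_logRate_eq {n k : ℝ} (hn : 0 < n) (hk : 0 < k) (t : ℕ) :
    k * logRate n t (n / k) =
      n * log n - n - k * log k + k + k * maxEntropy t (n / k) := by
  rw [logRate, log_div hn.ne' hk.ne']
  have : k * (n / k) = n := mul_div_cancel₀ _ hk.ne'
  linear_combination (log n - 1) * this

theorem profile_term_le {n k t : ℕ} (hn : 1 ≤ n) (hk : 1 ≤ k) {c : Fin t → ℕ}
    (hc : c ∈ profiles n k t) :
    n.factorial * ∏ i, (((c i).factorial : ℝ) * dI (i.1 + 1) ^ c i)⁻¹ ≤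
      exp (1 + log n + k * logRate n t (n / k)) := by
  obtain ⟨h1, h2⟩ := mem_profiles.1 hc
  have hk0 : (0 : ℝ) < k := by exact_mod_cast hk
  have hn0 : (0 : ℝ) < n := by exact_mod_cast hn
  have h1' : ∑ i, (c i : ℝ) = k := by exact_mod_cast h1
  have h2' : ∑ i : Fin t, ((i.1 + 1 : ℕ) : ℝ) * (c i : ℝ) = n := by exact_mod_cast h2
  have hkq : ∀ i, (k : ℝ) * (c i / k) = c i := fun i => mul_div_cancel₀ _ hk0.ne'
  have hq : (fun i => (c i : ℝ) / k) ∈ Ptilde ((n : ℝ) / k) t := by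
    refine ⟨fun i => ⟨by positivity, ?_⟩, ?_, ?_⟩
    · rw [div_le_one hk0]
      have := Finset.single_le_sum (fun j _ => Nat.zero_le (c j)) (Finset.mem_univ i)
      rw [h1] at this
      exact_mod_cast this
    · rw [← Finset.sum_div, h1', div_self hk0.ne']
    · simp only [← mul_div_assoc]
      rw [← Finset.sum_div, h2']
  have h3 := sum_scaled_eq hk0 hq.2.1
  simp only [hkq] at h3
  have h4 : ∑ i : Fin t, (c i * log (c i) - c i + c i * log (dI (i.1 + 1))) ≤
      ∑ i : Fin t, (log (c i).factorial + c i * log (dI (i.1 + 1))) :=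
    Finset.sum_le_sum fun i _ => by
      have := mul_log_sub_le_log_factorial (c i)
      linarith
  have h5 := mul_le_mul_of_nonneg_left (partEntropy_le_maxEntropy hq) hk0.le
  rw [← log_le_iff_le_exp (mul_pos (by positivity) (profile_term_pos c)),
    log_mul (by positivity) (profile_term_pos c).ne', log_prod_inv, mul_logRate_eq hn0 hk0]
  have h6 := log_factorial_le hn
  linarith

theorem card_profiles_le (n k t : ℕ) : (profiles n k t).card ≤ (k + 1) ^ t := by
  have : profiles n k t ⊆ Fintype.piFinset fun _ => Finset.range (k + 1) := by
    intro c hc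
    rw [Fintype.mem_piFinset]
    intro i
    have := Finset.single_le_sum (fun j _ => Nat.zero_le (c j)) (Finset.mem_univ i)
    rw [(mem_profiles.1 hc).1] at this
    exact Finset.mem_range.2 (Nat.lt_succ_of_le this)
  simpa using Finset.card_le_card this

/-- A first-moment upper bound. -/
theorem logRate_bound_of_one_le_EE {n k t : ℕ} (hn : 1 ≤ n) (hE : 1 ≤ EE n k t) :
    1 ≤ k ∧ k ≤ n ∧ n ≤ t * k ∧
      0 ≤ t * log (k + 1) + (1 + log n) + k * logRate n t (n / k) := by
  have hne : (profiles n k t).Nonempty := by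
    by_contra h
    rw [Finset.not_nonempty_iff_eq_empty] at h
    rw [EE_eq_sum_profiles, h] at hE
    norm_num at hE
  obtain ⟨c, hc⟩ := hne
  obtain ⟨h1, h2⟩ := profile_bounds hc
  have hk : 1 ≤ k := by
    rcases Nat.eq_zero_or_pos k with rfl | h
    · omega
    · exact h
  refine ⟨hk, h1, h2, ?_⟩
  have hle : EE n k t ≤
      ((k : ℝ) + 1) ^ t * exp (1 + log n + k * logRate n t (n / k)) := by
    rw [EE_eq_sum_profiles, Finset.mul_sum]
    refine (Finset.sum_le_card_nsmul _ _ _ fun c hc => profile_term_le hn hk hc).trans ?_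
    rw [nsmul_eq_mul]
    refine mul_le_mul_of_nonneg_right ?_ (exp_pos _).le
    exact_mod_cast card_profiles_le n k t
  have h3 := log_le_log one_pos (hE.trans hle)
  rw [log_one, log_mul (by positivity) (exp_pos _).ne', log_exp, log_pow] at h3
  linarith

theorem exists_profile {a b t : ℕ} (h1 : a ≤ b) (h2 : b ≤ t * a) :
    (profiles b a t).Nonempty := by
  classical
  induction a generalizing b with
  | zero => exact ⟨0, mem_profiles.2 ⟨by simp, by simp; omega⟩⟩
  | succ a ih =>
    have ht : 1 ≤ t := by
      rcases Nat.eq_zero_or_pos t with rfl | h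
      · omega
      · exact h
    rw [Nat.mul_succ] at h2
    obtain ⟨s, hs1, hst, hsb, hs2, hs3⟩ : ∃ s, 1 ≤ s ∧ s ≤ t ∧ s ≤ b ∧ a ≤ b - s ∧
        b - s ≤ t * a := by
      rcases le_total t (b - a) with h | h
      · exact ⟨t, ht, le_rfl, by omega, by omega, by omega⟩
      · have := Nat.le_mul_of_pos_left a ht
        exact ⟨b - a, by omega, h, by omega, by omega, by omega⟩
    obtain ⟨r, hr⟩ := ih hs2 hs3
    obtain ⟨hr1, hr2⟩ := mem_profiles.1 hr
    refine ⟨r + Pi.single ⟨s - 1, by omega⟩ 1, mem_profiles.2 ⟨?_, ?_⟩⟩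
    · simp [Finset.sum_add_distrib, hr1]
    · simp only [Pi.add_apply, mul_add, Finset.sum_add_distrib, hr2, Pi.single_apply]
      simp
      omega

theorem dI_mono {i j : ℕ} (h : i ≤ j) : dI i ≤ dI j := by
  unfold dI
  gcongr
  norm_num

/-- A first-moment lower bound from a single profile close to `k * q`. -/
theorem exp_le_EE {n k t : ℕ} (hk : 1 ≤ k) {q : Fin t → ℝ}
    (hq : q ∈ Ptilde ((n : ℝ) / k) t) :
    exp (n * log n - n - k * log k + k + k * partEntropy q -
      t * (2 + 2 * log (n + 1) + log (dI t))) ≤ EE n k t := by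
  obtain ⟨h01, hsum, hmean⟩ := hq
  have hk0 : (0 : ℝ) < k := by exact_mod_cast hk
  set x : Fin t → ℝ := fun i => k * q i with hx
  have hx0 : ∀ i, 0 ≤ x i := fun i => mul_nonneg hk0.le (h01 i).1
  have hxk : ∀ i, x i ≤ k := fun i => by
    have := mul_le_mul_of_nonneg_left (h01 i).2 hk0.le
    rwa [mul_one] at this
  have hxsum : ∑ i, x i = k := by rw [← Finset.mul_sum, hsum, mul_one]
  have hxmean : ∑ i : Fin t, ((i.1 + 1 : ℕ) : ℝ) * x i = n := by
    simp only [hx, mul_left_comm _ (k : ℝ)]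
    rw [← Finset.mul_sum, hmean, mul_div_cancel₀ _ hk0.ne']
  set fl : Fin t → ℕ := fun i => ⌊x i⌋₊ with hfl
  have hfl1 : ∀ i, (fl i : ℝ) ≤ x i := fun i => Nat.floor_le (hx0 i)
  have hfl2 : ∀ i, x i ≤ fl i + 1 := fun i => (Nat.lt_floor_add_one _).le
  have hs1 : ∑ i, fl i ≤ k := by
    have := Finset.sum_le_sum fun i (_ : i ∈ Finset.univ) => hfl1 i
    rw [hxsum] at this
    exact_mod_cast this
  have hs2 : ∑ i : Fin t, (i.1 + 1) * fl i ≤ n := by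
    have := Finset.sum_le_sum fun i (_ : i ∈ Finset.univ) =>
      mul_le_mul_of_nonneg_left (hfl1 i) (Nat.cast_nonneg (α := ℝ) (i.1 + 1))
    rw [hxmean] at this
    exact_mod_cast this
  have hd1 : ((k - ∑ i, fl i : ℕ) : ℝ) = ∑ i, (x i - fl i) := by
    rw [Nat.cast_sub hs1, Finset.sum_sub_distrib, hxsum]
    push_cast
    rfl
  have hd2 : ((n - ∑ i : Fin t, (i.1 + 1) * fl i : ℕ) : ℝ) =
      ∑ i : Fin t, ((i.1 + 1 : ℕ) : ℝ) * (x i - fl i) := by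
    simp only [mul_sub]
    rw [Nat.cast_sub hs2, Finset.sum_sub_distrib, hxmean]
    push_cast
    rfl
  have hle1 : k - ∑ i, fl i ≤ n - ∑ i : Fin t, (i.1 + 1) * fl i := by
    have : ((k - ∑ i, fl i : ℕ) : ℝ) ≤ ((n - ∑ i : Fin t, (i.1 + 1) * fl i : ℕ) : ℝ) := by
      rw [hd1, hd2]
      refine Finset.sum_le_sum fun i _ => ?_
      have h1 : (1 : ℝ) ≤ ((i.1 + 1 : ℕ) : ℝ) := by exact_mod_cast Nat.succ_pos _
      have := hfl1 i
      nlinarith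
    exact_mod_cast this
  have hle2 : n - ∑ i : Fin t, (i.1 + 1) * fl i ≤ t * (k - ∑ i, fl i) := by
    have : ((n - ∑ i : Fin t, (i.1 + 1) * fl i : ℕ) : ℝ) ≤
        (t : ℝ) * ((k - ∑ i, fl i : ℕ) : ℝ) := by
      rw [hd1, hd2, Finset.mul_sum]
      refine Finset.sum_le_sum fun i _ => ?_
      have h1 : ((i.1 + 1 : ℕ) : ℝ) ≤ t := by exact_mod_cast i.2
      have := hfl1 i
      exact mul_le_mul_of_nonneg_right h1 (by linarith)
    exact_mod_cast this
  obtain ⟨r, hr⟩ := exists_profile hle1 hle2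
  obtain ⟨hr1, hr2⟩ := mem_profiles.1 hr
  have hrt : ∑ i, (r i : ℝ) ≤ t := by
    have h1 : ∑ i, (r i : ℝ) = ∑ i, (x i - fl i) := by
      rw [← hd1, ← hr1]
      push_cast
      rfl
    rw [h1]
    have h2 : ∑ i, (x i - fl i) ≤ ∑ _i : Fin t, (1 : ℝ) :=
      Finset.sum_le_sum fun i _ => by linarith [hfl2 i]
    simpa using h2
  have hc : (fun i => fl i + r i) ∈ profiles n k t := by
    rw [mem_profiles]
    simp only [mul_add, Finset.sum_add_distrib, hr1, hr2]
    omega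
  obtain ⟨hkn, -⟩ := profile_bounds hc
  have hn : 1 ≤ n := hk.trans hkn
  have hn1 : (1 : ℝ) ≤ n := by exact_mod_cast hn
  have hkn' : (k : ℝ) ≤ n := by exact_mod_cast hkn
  have hln : 0 ≤ log (n : ℝ) := log_nonneg hn1
  have hci : ∀ i, fl i + r i ≤ k := fun i => by
    have := Finset.single_le_sum (f := fun i => fl i + r i) (fun j _ => Nat.zero_le _)
      (Finset.mem_univ i)
    rwa [(mem_profiles.1 hc).1] at this
  have hterm : ∀ i : Fin t, log ((fl i + r i).factorial) +
      ((fl i + r i : ℕ) : ℝ) * log (dI (i.1 + 1)) ≤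
      (x i * log (x i) - x i + x i * log (dI (i.1 + 1))) + (2 + log (n + 1)) +
        r i * (log n + log (dI t)) := by
    intro i
    have h1 : log ((fl i + r i).factorial) ≤ log ((fl i).factorial) + r i * log n := by
      rcases Nat.eq_zero_or_pos (fl i + r i) with h | h
      · have h0 : fl i = 0 := by omega
        have h0' : r i = 0 := by omega
        simp [h0, h0']
      · have h2 := log_factorial_tangent_le h (fl i)
        have h3 : log ((fl i + r i : ℕ) : ℝ) ≤ log n := by
          refine log_le_log (by exact_mod_cast h) ?_
          exact_mod_cast (hci i).trans hkn
        have h4 := mul_le_mul_of_nonneg_left h3 (Nat.cast_nonneg (α := ℝ) (r i))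
        push_cast at h2 h4
        linarith
    have h2 := log_factorial_floor_le (hx0 i)
    have h3 : log (x i + 1) ≤ log (n + 1) :=
      log_le_log (by linarith [hx0 i]) (by linarith [hxk i])
    have h4 : 0 ≤ log (dI (i.1 + 1)) := log_nonneg (one_le_dI _)
    have h5 : log (dI (i.1 + 1)) ≤ log (dI t) := log_le_log (dI_pos _) (dI_mono i.2)
    have h6 := mul_le_mul_of_nonneg_right (hfl1 i) h4
    have h7 := mul_le_mul_of_nonneg_left h5 (Nat.cast_nonneg (α := ℝ) (r i))
    push_cast
    have h8 : log ((fl i).factorial) ≤ x i * log (x i) - x i + 2 + log (x i + 1) := h2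
    linarith
  have hS := Finset.sum_le_sum fun i (_ : i ∈ Finset.univ) => hterm i
  have hscaled : ∑ i : Fin t, (x i * log (x i) - x i + x i * log (dI (i.1 + 1))) =
      k * log k - k - k * partEntropy q := sum_scaled_eq hk0 hsum
  have hR : ∑ i : Fin t, ((x i * log (x i) - x i + x i * log (dI (i.1 + 1))) +
      (2 + log (n + 1)) + r i * (log n + log (dI t))) =
      (k * log k - k - k * partEntropy q) + t * (2 + log (n + 1)) +
        (∑ i, (r i : ℝ)) * (log n + log (dI t)) := by
    rw [Finset.sum_add_distrib, Finset.sum_add_distrib, hscaled, ← Finset.sum_mul,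
      Finset.sum_const, Finset.card_univ, Fintype.card_fin, nsmul_eq_mul]
  rw [hR] at hS
  have hS2 := mul_le_mul_of_nonneg_right hrt
    (show 0 ≤ log (n : ℝ) + log (dI t) from add_nonneg hln (log_nonneg (one_le_dI _)))
  have hll : log (n : ℝ) ≤ log (n + 1) := log_le_log (by linarith) (by linarith)
  have hll' := mul_le_mul_of_nonneg_left hll (Nat.cast_nonneg (α := ℝ) t)
  have hfac := mul_log_sub_le_log_factorial n
  have hpos := profile_term_pos fun i => fl i + r i
  have hone : exp (n * log n - n - k * log k + k + k * partEntropy q -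
      t * (2 + 2 * log (n + 1) + log (dI t))) ≤
      n.factorial * ∏ i, (((fl i + r i).factorial : ℝ) * dI (i.1 + 1) ^ (fl i + r i))⁻¹ := by
    rw [← le_log_iff_exp_le (mul_pos (by positivity) hpos),
      log_mul (by positivity) hpos.ne', log_prod_inv fun i => fl i + r i]
    linarith
  refine hone.trans ?_
  rw [EE_eq_sum_profiles]
  refine mul_le_mul_of_nonneg_left ?_ (by positivity)
  exact Finset.single_le_sum
    (f := fun c : Fin t → ℕ => ∏ i, (((c i).factorial : ℝ) * dI (i.1 + 1) ^ c i)⁻¹)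
    (fun c _ => (profile_term_pos c).le) hc

theorem eventually_log_bounds (M δ : ℝ) (hδ : 0 < δ) :
    ∀ᶠ n : ℝ in atTop, M ≤ log n ∧ M ≤ log (log n) ∧ log (log n) ≤ δ * log n := by
  have h1 := tendsto_log_atTop.eventually_ge_atTop M
  have h2 := (tendsto_log_atTop.comp tendsto_log_atTop).eventually_ge_atTop M
  have h3 := (isLittleO_log_id_atTop.comp_tendsto tendsto_log_atTop).bound hδ
  have h4 := tendsto_log_atTop.eventually_ge_atTop 0
  filter_upwards [h1, h2, h3, h4] with n h1 h2 h3 h4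
  simp only [Function.comp_apply, id, norm_eq_abs, abs_of_nonneg h4] at h2 h3
  exact ⟨h1, h2, (le_abs_self _).trans h3⟩

/-- The constant term of `alpha0 2 n * log 2`. -/
noncomputable def alphaConst : ℝ := 2 * log (log 2) + 2 - log 2

theorem alpha0_mul_log_two {n : ℝ} (hn : 0 < log n) :
    alpha0 2 n * log 2 = 2 * (log n - log (log n)) + alphaConst := by
  have h2 : 0 < log 2 := log_pos one_lt_two
  rw [alpha0, logb, logb, logb, log_div hn.ne' h2.ne', log_div (exp_pos 1).ne' two_ne_zero,
    log_exp, alphaConst]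
  field_simp
  ring

/-- `alphaNat` and nearby reals are of order `log n`. -/
theorem eventually_alpha_bounds : ∀ᶠ n : ℝ in atTop,
    (alphaNat 2 n : ℝ) ≤ alpha0 2 n ∧ alpha0 2 n < alphaNat 2 n + 1 ∧
      ∀ ρ, |ρ - alpha0 2 n| ≤ 300 → log n ≤ ρ ∧ ρ ≤ 4 * log n := by
  filter_upwards [eventually_log_bounds (1000 + 10 * |alphaConst|) (1 / 100) (by norm_num)]
    with n ⟨h1, h2, h3⟩
  have hc := abs_nonneg alphaConst
  have hc1 := le_abs_self alphaConst
  have hc2 := neg_abs_le alphaConst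
  have hα := alpha0_mul_log_two (n := n) (by linarith)
  have hl1 := log_two_gt_d9
  have hl2 := log_two_lt_d9
  have hlow : log n + 300 ≤ alpha0 2 n := by
    by_contra! h
    nlinarith
  have hup : alpha0 2 n ≤ 4 * log n - 300 := by
    by_contra! h
    nlinarith
  have hcast : (alphaNat 2 n : ℝ) = (⌊alpha0 2 n⌋ : ℝ) := by
    have : 0 ≤ ⌊alpha0 2 n⌋ := Int.floor_nonneg.2 (by linarith)
    rw [alphaNat]
    exact_mod_cast Int.toNat_of_nonneg this
  refine ⟨?_, ?_, fun ρ hρ => ?_⟩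
  · rw [hcast]
    exact Int.floor_le _
  · rw [hcast]
    exact Int.lt_floor_add_one _
  · obtain ⟨h4, h5⟩ := abs_le.1 hρ
    constructor <;> linarith

theorem abs_log_sub_log_le {x y : ℝ} (hy : 0 < y) (h1 : y ≤ x) (h2 : x ≤ 4 * y) :
    |log x - log y| ≤ 2 := by
  have h3 : log x ≤ log 4 + log y := by
    rw [← log_mul (by norm_num) hy.ne']
    exact log_le_log (by linarith) h2
  have h4 : log y ≤ log x := log_le_log hy h1
  have h5 : log 4 = 2 * log 2 := by
    rw [show (4 : ℝ) = 2 ^ 2 by norm_num, log_pow]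
    norm_num
  have := log_two_lt_d9
  rw [abs_le]
  constructor <;> linarith

theorem abs_log_muR_sub_le {n : ℝ} {a : ℕ} (hn : 1 ≤ n) (ha : 2 * (a : ℝ) ^ 2 ≤ n) :
    |log (muR (1 / 2) a n) - (a * log n - log (dI a))| ≤ 1 := by
  rcases Nat.eq_zero_or_pos a with rfl | hpos
  · simp [muR, dI]
  have ha1 : (1 : ℝ) ≤ a := by exact_mod_cast hpos
  have hi : ∀ i ∈ Finset.range a, 0 < n - (i : ℝ) := by
    intro i hi
    have : (i : ℝ) < a := by exact_mod_cast Finset.mem_range.1 hi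
    nlinarith
  have h1 : log (muR (1 / 2) a n) = ∑ i ∈ Finset.range a, log (n - i) - log (dI a) := by
    rw [muR, log_mul (div_ne_zero (Finset.prod_pos hi).ne' (by positivity)) (by positivity),
      log_div (Finset.prod_pos hi).ne' (by positivity), log_prod fun i h => (hi i h).ne',
      log_pow, one_div, log_inv, log_dI]
    ring
  have h2 : ∑ i ∈ Finset.range a, log (n - i) ≤ ∑ _i ∈ Finset.range a, log n :=
    Finset.sum_le_sum fun i h => log_le_log (hi i h) (by linarith [Nat.cast_nonneg (α := ℝ) i])
  have h3 : ∑ _i ∈ Finset.range a, (log n - 1 / a) ≤ ∑ i ∈ Finset.range a, log (n - i) := by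
    refine Finset.sum_le_sum fun i h => ?_
    have hia : (i : ℝ) < a := by exact_mod_cast Finset.mem_range.1 h
    have h4 := one_sub_inv_le_log_of_pos (show 0 < (n - i) / n from div_pos (hi i h) (by linarith))
    rw [log_div (hi i h).ne' (by linarith), inv_div] at h4
    have h5 : n / (n - i) - 1 ≤ 1 / a := by
      rw [div_sub_one (hi i h).ne', div_le_div_iff₀ (hi i h) (by linarith)]
      nlinarith
    linarith
  rw [Finset.sum_const, Finset.card_range, nsmul_eq_mul] at h2 h3
  have h6 : (a : ℝ) * (log n - 1 / a) = a * log n - 1 := by field_simp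
  rw [h1, abs_le]
  constructor <;> linarith

theorem eventually_log_muR : ∀ᶠ n : ℝ in atTop,
    |log (muR (1 / 2) (alphaNat 2 n) n) - (alphaNat 2 n * log n - log (dI (alphaNat 2 n)))| ≤
      1 := by
  have h := (isLittleO_pow_log_id_atTop (n := 2)).bound (show (0 : ℝ) < 1 / 32 by norm_num)
  filter_upwards [eventually_alpha_bounds, h, eventually_ge_atTop 1] with n ⟨h1, h2, h3⟩ h4 h5
  refine abs_log_muR_sub_le h5 ?_
  obtain ⟨h6, h7⟩ := h3 (alphaNat 2 n) (abs_le.2 ⟨by linarith, by linarith⟩)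
  simp only [id, norm_eq_abs] at h4
  rw [abs_of_nonneg (by positivity), abs_of_nonneg (by linarith)] at h4
  have := log_nonneg h5
  nlinarith

theorem exists_dSlope_bound : ∃ C : ℝ, ∀ᶠ n : ℝ in atTop,
    |dSlope (alphaNat 2 n) - (2 * log n - log (log n))| ≤ C := by
  refine ⟨|alphaConst| + 4, ?_⟩
  filter_upwards [eventually_alpha_bounds, eventually_log_bounds 1 1 one_pos]
    with n ⟨h1, h2, h3⟩ ⟨h4, h5, h6⟩
  have hα := alpha0_mul_log_two (n := n) (by linarith)
  obtain ⟨h7, h8⟩ := h3 (alphaNat 2 n) (abs_le.2 ⟨by linarith, by linarith⟩)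
  have h9 := abs_le.1 (abs_log_sub_log_le (by linarith) h7 h8)
  have hl1 := log_two_gt_d9
  have hl2 := log_two_lt_d9
  have hc1 := le_abs_self alphaConst
  have hc2 := neg_abs_le alphaConst
  rw [dSlope, abs_le]
  constructor <;> nlinarith

/-- `logRate` near `alpha0` in terms of `muR`, up to a bounded error. -/
theorem exists_logRate_muR_bound : ∃ C : ℝ, ∀ᶠ n : ℝ in atTop, ∀ (t : ℕ) (ρ : ℝ),
    |ρ - alpha0 2 n| ≤ 250 → ρ < t →
    |logRate n t ρ - (log (muR (1 / 2) (alphaNat 2 n) n) +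
      (alphaNat 2 n - ρ - 1 - 2 / log 2) * (log n - log (log n)))| ≤ C := by
  obtain ⟨C₁, hC₁⟩ := exists_partEntropy_le
  obtain ⟨C₂, hC₂⟩ := exists_dSlope_bound
  refine ⟨|C₁| + 2 * (251 + 1) ^ 2 + 251 * |C₂| + 2 * |alphaConst| + 260, ?_⟩
  filter_upwards [eventually_alpha_bounds, eventually_log_bounds 1 1 one_pos, hC₂,
    eventually_log_muR] with n ⟨h1, h2, h3⟩ ⟨h4, h5, h6⟩ h7 h8 t ρ hρ hρt
  have hα := alpha0_mul_log_two (n := n) (by linarith)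
  obtain ⟨h9, h10⟩ := h3 (alphaNat 2 n) (abs_le.2 ⟨by linarith, by linarith⟩)
  obtain ⟨h11, h12⟩ := h3 ρ (hρ.trans (by norm_num))
  have h13 := abs_le.1 (abs_log_sub_log_le (by linarith) h11 h12)
  set a := alphaNat 2 n with ha
  have ha1 : 1 ≤ a := by
    have : (1 : ℝ) ≤ a := by linarith
    exact_mod_cast this
  have hρa : |ρ - a| ≤ 251 := by
    obtain ⟨h, h'⟩ := abs_le.1 hρ
    exact abs_le.2 ⟨by linarith, by linarith⟩
  have hlow := le_maxEntropy ha1 (by linarith) hρt hρa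
  have hup : maxEntropy t ρ ≤ -log (dI a) - dSlope a * (ρ - a) + C₁ := by
    refine csSup_le ((Ptilde_nonempty ⟨by linarith, hρt.le⟩).image _) ?_
    rintro _ ⟨q, hq, rfl⟩
    exact hC₁ t a ρ q ha1 hq
  have hl1 := log_two_gt_d9
  have hslope : |(dSlope a - (2 * log n - log (log n))) * (ρ - a)| ≤ 251 * |C₂| := by
    rw [abs_mul, mul_comm (251 : ℝ)]
    exact mul_le_mul (h7.trans (le_abs_self _)) hρa (abs_nonneg _) (abs_nonneg _)
  have hdiv : |2 / log 2 * (log n - log (log n)) - alpha0 2 n| ≤ 2 * |alphaConst| := by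
    have : 2 / log 2 * (log n - log (log n)) - alpha0 2 n = -(alphaConst / log 2) := by
      have hα' : alpha0 2 n = (2 * (log n - log (log n)) + alphaConst) / log 2 := by
        rw [eq_div_iff (by linarith)]
        exact hα
      rw [hα']
      ring
    rw [this, abs_neg, abs_div, abs_of_pos (show 0 < log 2 by linarith),
      div_le_iff₀ (by linarith)]
    nlinarith [abs_nonneg alphaConst]
  obtain ⟨h14, h15⟩ := abs_le.1 hslope
  obtain ⟨h16, h17⟩ := abs_le.1 hdiv
  obtain ⟨h18, h19⟩ := abs_le.1 h8
  obtain ⟨h20, h21⟩ := abs_le.1 hρ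
  have hC₁' := le_abs_self C₁
  have hC₁'' := abs_nonneg C₁
  rw [logRate, abs_le]
  constructor <;> nlinarith

theorem exists_log_muR_bound : ∃ C : ℝ, ∀ᶠ n : ℝ in atTop,
    |log (muR (1 / 2) (alphaNat 2 n) n) -
      (alpha0 2 n - alphaNat 2 n) * (log n - log (log n))| ≤ C * log (log n) := by
  refine ⟨20, ?_⟩
  filter_upwards [eventually_alpha_bounds,
    eventually_log_bounds (10 + 10 * |alphaConst|) (1 / 100) (by norm_num),
    eventually_log_muR] with n ⟨h1, h2, h3⟩ ⟨h4, h5, h6⟩ h7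
  have hc0 := abs_nonneg alphaConst
  have hα := alpha0_mul_log_two (n := n) (by linarith)
  obtain ⟨h9, h10⟩ := h3 (alphaNat 2 n) (abs_le.2 ⟨by linarith, by linarith⟩)
  have h11 := abs_le.1 (abs_log_sub_log_le (by linarith) h9 h10)
  obtain ⟨h18, h19⟩ := abs_le.1 h7
  set a := alphaNat 2 n with ha
  set l := log n with hl
  set s := alpha0 2 n - a with hs
  have hs0 : 0 ≤ s := by linarith
  have hs1 : s < 1 := by linarith
  have hl1 := log_two_gt_d9
  have hl2 := log_two_lt_d9
  have hc1 := le_abs_self alphaConst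
  have hc2 := neg_abs_le alphaConst
  have ha1 : 1 ≤ a := by
    have : (1 : ℝ) ≤ a := by linarith
    exact_mod_cast this
  have hfl := mul_log_sub_le_log_factorial a
  have hfu := log_factorial_le ha1
  have ha0 : (0 : ℝ) < a := by linarith
  have has : (a : ℝ) * log 2 = 2 * (l - log l) + alphaConst - s * log 2 := by
    rw [← hα, hs]; ring
  set r := 2 * l / (a * log 2) with hr
  have hr0 : 0 < r := by
    have : 0 < l := by linarith
    have : 0 < log 2 := by linarith
    positivity
  have hlogr : log r = log 2 + log l - log a - log (log 2) := by
    rw [hr, log_div (mul_ne_zero two_ne_zero (by linarith)) (mul_ne_zero ha0.ne' (by linarith)),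
      log_mul two_ne_zero (by linarith), log_mul ha0.ne' (by linarith)]
    ring
  have har : (a : ℝ) * r * log 2 = 2 * l := by
    rw [hr]
    have : log 2 ≠ 0 := by linarith
    field_simp
  have hsl : 0 ≤ s * log 2 := mul_nonneg hs0 (by linarith)
  have hsl' : s * log 2 ≤ 1 := by nlinarith
  have hr1 : 1 ≤ r := by
    rw [hr, one_le_div (mul_pos ha0 (by linarith))]
    linarith
  have hru : (a : ℝ) * log r ≤ 6 * log l := by
    have h := mul_le_mul_of_nonneg_left (log_le_sub_one_of_pos hr0) ha0.le
    have h' : (a : ℝ) * (r - 1) * log 2 ≤ 3 * log l := by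
      have : (a : ℝ) * (r - 1) * log 2 = 2 * l - a * log 2 := by linarith
      linarith
    have h'' : (a : ℝ) * (r - 1) ≤ 6 * log l := by
      have : 0 ≤ (a : ℝ) * (r - 1) := mul_nonneg ha0.le (by linarith)
      have := mul_le_mul_of_nonneg_left (show 1 / 2 ≤ log 2 by linarith) this
      linarith
    linarith
  have hrl : 0 ≤ (a : ℝ) * log r := mul_nonneg ha0.le (log_nonneg hr1)
  have hd : a * l - log (dI a) = a * log r + a * s * log 2 / 2 - (log a.factorial -
      (a * log a - a)) := by
    rw [log_dI, Nat.cast_choose_two, hlogr]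
    have hLL : log l = l - ((a : ℝ) * log 2 + s * log 2 - alphaConst) / 2 := by linarith
    rw [hLL, alphaConst]
    ring
  have hmain : |(a : ℝ) * s * log 2 / 2 - s * (l - log l)| ≤ log l := by
    have : (a : ℝ) * s * log 2 / 2 - s * (l - log l) =
        s * ((alphaConst - s * log 2) / 2) := by
      have : (a : ℝ) * s * log 2 / 2 = s * ((a : ℝ) * log 2) / 2 := by ring
      rw [this, has]
      ring
    rw [this, abs_mul, abs_of_nonneg hs0]
    have h : |(alphaConst - s * log 2) / 2| ≤ log l := by
      rw [abs_le]
      constructor <;> linarith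
    exact (mul_le_of_le_one_left (abs_nonneg _) hs1.le).trans h
  obtain ⟨h20, h21⟩ := abs_le.1 hmain
  rw [abs_le]
  constructor <;> linarith

theorem exists_logRate_bound : ∃ C : ℝ, 0 ≤ C ∧ ∀ᶠ n : ℝ in atTop, ∀ (t : ℕ) (ρ : ℝ),
    |ρ - alpha0 2 n| ≤ 250 → ρ < t →
    |logRate n t ρ - (alpha0 2 n - ρ - 1 - 2 / log 2) * (log n - log (log n))| ≤
      C * log (log n) := by
  obtain ⟨C₁, h₁⟩ := exists_logRate_muR_bound
  obtain ⟨C₂, h₂⟩ := exists_log_muR_bound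
  refine ⟨|C₁| + |C₂|, by positivity, ?_⟩
  filter_upwards [h₁, h₂, eventually_log_bounds 1 1 one_pos] with n h1 h2 ⟨h3, h4, h5⟩ t ρ hρ hρt
  have h6 := abs_add_le _ _ |>.trans (add_le_add (h1 t ρ hρ hρt) h2)
  have h7 : C₁ ≤ |C₁| * log (log n) :=
    (le_abs_self _).trans (le_mul_of_one_le_right (abs_nonneg _) h4)
  have h8 : C₂ * log (log n) ≤ |C₂| * log (log n) :=
    mul_le_mul_of_nonneg_right (le_abs_self _) (by linarith)
  have h9 : ∀ x y z : ℝ, x - (y + z) + (y - (alpha0 2 n - alphaNat 2 n) *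
      (log n - log (log n))) = x - (z + (alpha0 2 n - alphaNat 2 n) * (log n - log (log n))) := by
    intros; ring
  rw [h9] at h6
  refine le_trans (le_of_eq ?_) (h6.trans (by linarith))
  congr 1
  ring

theorem slope_chain {f : ℝ → ℝ} {l r c u v : ℝ} (hf : ConcaveOn ℝ (Set.Icc l r) f) (hl : l ≤ u)
    (huv : u < v) (hc : f v - f u ≤ c * (v - u)) {x y : ℝ} (hx : v ≤ x) (hxy : x < y)
    (hy : y ≤ r) : f y - f x ≤ c * (y - x) := by
  have h1 : (f v - f u) / (v - u) ≤ c := (div_le_iff₀ (by linarith)).2 hc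
  have h2 : (f y - f x) / (y - x) ≤ (f x - f u) / (x - u) :=
    hf.slope_anti_adjacent ⟨hl, by linarith⟩ ⟨by linarith, hy⟩ (by linarith) hxy
  have h3 : (f x - f u) / (x - u) ≤ c := by
    rcases hx.eq_or_lt with rfl | hx
    · exact h1
    · have h4 : (f x - f v) / (x - v) ≤ (f v - f u) / (v - u) :=
        hf.slope_anti_adjacent ⟨hl, by linarith⟩ ⟨by linarith, by linarith⟩ huv hx
      have h5 := (div_le_iff₀ (by linarith)).1 (h4.trans h1)
      rw [div_le_iff₀ (by linarith)]
      linarith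
  exact (div_le_iff₀ (by linarith)).1 (h2.trans h3)

/-- `logRate` decreases at rate at least `log n / 2` above `alpha0 - 101`. -/
theorem eventually_logRate_slope : ∀ᶠ n : ℝ in atTop, ∀ t : ℕ, alpha0 2 n - 100 ≤ t →
    ∀ x y : ℝ, alpha0 2 n - 101 ≤ x → x < y → y ≤ t →
      logRate n t y - logRate n t x ≤ -(log n / 2) * (y - x) := by
  obtain ⟨C, hC0, hC⟩ := exists_logRate_bound
  filter_upwards [hC, eventually_alpha_bounds,
    eventually_log_bounds 1 (1 / (100 + C)) (by positivity)]
    with n h ⟨h1, h2, h3⟩ ⟨h4, h5, h6⟩ t ht x y hx hxy hy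
  have h7 : (100 + C) * log (log n) ≤ log n := by
    rwa [one_div, ← div_eq_inv_mul, le_div_iff₀' (by positivity)] at h6
  obtain ⟨h8, -⟩ := h3 (alpha0 2 n - 200) (by norm_num)
  have hu := (abs_le.1 (h t (alpha0 2 n - 200) (by norm_num) (by linarith))).1
  have hv := (abs_le.1 (h t (alpha0 2 n - 101) (by norm_num) (by linarith))).2
  refine slope_chain (concaveOn_logRate n t) (u := alpha0 2 n - 200) (v := alpha0 2 n - 101)
    (by linarith) (by linarith) ?_ hx hxy hy
  nlinarith

theorem two_div_log_two_mem : 2 < 2 / log 2 ∧ 2 / log 2 < 3 := by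
  have h1 := log_two_gt_d9
  have h2 := log_two_lt_d9
  constructor
  · rw [lt_div_iff₀ (by linarith)]
    linarith
  · rw [div_lt_iff₀ (by linarith)]
    linarith

theorem eventually_exists_logRate_eq_zero {ε : ℝ} (hε : 0 < ε) : ∀ᶠ n : ℝ in atTop, ∀ t : ℕ,
    alpha0 2 n - 1 - 2 / log 2 + ε ≤ t → t ≤ alpha0 2 n + 100 →
      ∃ ρ ∈ Set.Icc (alpha0 2 n - 100) (t - ε / 4), logRate n t ρ = 0 := by
  obtain ⟨C, hC0, hC⟩ := exists_logRate_bound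
  filter_upwards [hC, eventually_alpha_bounds,
    eventually_log_bounds 1 (1 / (2 + C)) (by positivity),
    eventually_log_bounds 1 (ε / (2 * ε + 2 * C)) (by positivity)]
    with n h ⟨h1, h2, h3⟩ ⟨h4, h5, h6⟩ ⟨_, _, h7⟩ t ht₁ ht₂
  obtain ⟨hl₁, hl₂⟩ := two_div_log_two_mem
  obtain ⟨h8, -⟩ := h3 (alpha0 2 n - 200) (by norm_num)
  have h9 : (2 + C) * log (log n) ≤ log n := by
    rwa [one_div, ← div_eq_inv_mul, le_div_iff₀' (by positivity)] at h6
  have h10 : (2 * ε + 2 * C) * log (log n) ≤ ε * log n := by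
    rwa [div_mul_eq_mul_div, le_div_iff₀' (by positivity)] at h7
  have hleft : 0 ≤ logRate n t (alpha0 2 n - 100) := by
    have h11 := (abs_le.1 (h t (alpha0 2 n - 100) (by norm_num) (by linarith))).1
    have h12 : 0 ≤ C * log (log n) := mul_nonneg hC0 (by linarith)
    have h13 : log n - log (log n) ≤ (alpha0 2 n - (alpha0 2 n - 100) - 1 - 2 / log 2) *
        (log n - log (log n)) := le_mul_of_one_le_left (by linarith) (by linarith)
    linarith
  have hright : logRate n t (t - ε / 4) ≤ 0 := by
    have h11 := (abs_le.1 (h t (t - ε / 4) (abs_le.2 ⟨by linarith, by linarith⟩)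
      (by linarith))).2
    have h12 : (alpha0 2 n - (t - ε / 4) - 1 - 2 / log 2) * (log n - log (log n)) ≤
        -(ε / 2) * (log n - log (log n)) :=
      mul_le_mul_of_nonneg_right (by linarith) (by nlinarith)
    nlinarith
  have hcont : ContinuousOn (logRate n t) (Set.Icc (alpha0 2 n - 100) (t - ε / 4)) := by
    refine (concaveOn_logRate n t).continuousOn_interior.mono ?_
    rw [interior_Icc]
    exact fun x hx => ⟨by linarith [hx.1], by linarith [hx.2]⟩
  exact intermediate_value_Icc' (by linarith) hcont ⟨hright, hleft⟩

theorem log_dI_le (t : ℕ) : log (dI t) ≤ 2 * (t : ℝ) ^ 2 := by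
  have h1 := log_two_lt_d9
  have h2 : log t.factorial ≤ t * t := by
    calc log t.factorial ≤ log ((t ^ t : ℕ) : ℝ) :=
          log_le_log (by positivity) (by exact_mod_cast t.factorial_le_pow)
      _ = t * log t := by rw [Nat.cast_pow, log_pow]
      _ ≤ t * t := mul_le_mul_of_nonneg_left (log_le_self t.cast_nonneg) t.cast_nonneg
  rw [log_dI, Nat.cast_choose_two]
  have h3 := t.cast_nonneg (α := ℝ)
  nlinarith [log_pos one_lt_two, mul_nonneg h3 (log_pos one_lt_two).le,
    mul_nonneg (mul_nonneg h3 h3) (show 0 ≤ 1 - log 2 by linarith)]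

theorem log_add_one_le_two_mul {x y : ℝ} (hx : 0 ≤ x) (hy : 2 ≤ y) (hxy : x ≤ y) :
    log (x + 1) ≤ 2 * log y := by
  have h : 2 * log y = log (y ^ 2) := by
    rw [log_pow]
    norm_num
  rw [h]
  exact log_le_log (by linarith) (by nlinarith)

/-- The slope hypothesis multiplied by the number of parts. -/
theorem le_mul_logRate {n ρ l k k₁ R : ℝ} (hk₁ : 0 < k₁) (hρ : ρ * k = n)
    (h : R ≤ -(l / 2) * (n / k₁ - ρ)) : k₁ * R ≤ l / 2 * ρ * (k₁ - k) := by
  have := mul_le_mul_of_nonneg_left h hk₁.le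
  have h2 : k₁ * (n / k₁) = n := mul_div_cancel₀ _ hk₁.ne'
  calc k₁ * R ≤ -(l / 2) * (k₁ * (n / k₁) - k₁ * ρ) := by linarith
    _ = l / 2 * ρ * (k₁ - k) := by rw [h2, ← hρ]; ring

theorem eventually_sub_le_of_one_le_EE : ∀ᶠ n : ℝ in atTop, ∀ m t k₀ : ℕ, (m : ℝ) = n →
    alpha0 2 n - 100 ≤ t → t ≤ alpha0 2 n + 100 → ∀ k : ℝ, 0 < k →
    alpha0 2 n - 100 ≤ n / k → logRate n t (n / k) = 0 → 1 ≤ EE m k₀ t →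
    k - 2 * log n ^ 2 ≤ k₀ := by
  filter_upwards [eventually_logRate_slope, eventually_alpha_bounds,
    eventually_log_bounds 1000 1 one_pos, eventually_ge_atTop 2]
    with n hslope ⟨_, _, hα⟩ ⟨hl, _, _⟩ hn m t k₀ hm ht₁ ht₂ k hk hk₁ hzero hE
  by_contra! hlt
  rw [← hm] at hn
  obtain ⟨h1, h2, h3, h4⟩ := logRate_bound_of_one_le_EE
    (by exact_mod_cast (show (1 : ℝ) ≤ m by linarith)) hE
  rw [hm] at h4 hn
  have hk₀ : (0 : ℝ) < k₀ := by exact_mod_cast h1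
  have hk₀n : (k₀ : ℝ) ≤ n := by rw [← hm]; exact_mod_cast h2
  have hn' : n ≤ t * k₀ := by rw [← hm]; exact_mod_cast h3
  have hkk : (k₀ : ℝ) < k := by nlinarith
  have hlow := (hα (alpha0 2 n - 100) (by norm_num)).1
  have hup := (hα t (abs_le.2 ⟨by linarith, by linarith⟩)).2
  have hs := hslope t ht₁ (n / k) (n / k₀) (by linarith)
    (div_lt_div_of_pos_left (by linarith) hk₀ hkk) ((div_le_iff₀ hk₀).2 hn')
  rw [hzero, sub_zero] at hs
  have h5 := le_mul_logRate hk₀ (div_mul_cancel₀ n hk.ne') hs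
  have h6 : log n / 2 * log n ≤ log n / 2 * (n / k) :=
    mul_le_mul_of_nonneg_left (by linarith) (by linarith)
  have h7 : log n / 2 * log n * (2 * log n ^ 2) ≤ log n / 2 * (n / k) * (k - k₀) :=
    mul_le_mul h6 (by linarith) (by positivity) (le_trans (by positivity) h6)
  have h8 : (t : ℝ) * log (k₀ + 1) ≤ 4 * log n * (2 * log n) :=
    mul_le_mul hup (log_add_one_le_two_mul hk₀.le hn hk₀n) (log_nonneg (by linarith))
      (by linarith)
  nlinarith [pow_pos (show 0 < log n by linarith) 2, pow_pos (show 0 < log n by linarith) 3]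

theorem eventually_one_le_EE : ∀ᶠ n : ℝ in atTop, ∀ m t : ℕ, (m : ℝ) = n →
    alpha0 2 n - 100 ≤ t → t ≤ alpha0 2 n + 100 → ∀ k : ℝ, 0 < k →
    alpha0 2 n - 100 ≤ n / k → n / k ≤ t → logRate n t (n / k) = 0 →
    1 ≤ EE m ⌈k + log n ^ 2⌉₊ t := by
  have hpow := (isLittleO_pow_log_id_atTop (n := 4)).bound (show (0 : ℝ) < 1 / 32 by norm_num)
  filter_upwards [eventually_logRate_slope, eventually_alpha_bounds,
    eventually_log_bounds 1000 1 one_pos, eventually_ge_atTop 2, hpow]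
    with n hslope ⟨_, _, hα⟩ ⟨hl, _, _⟩ hn hpow m t hm ht₁ ht₂ k hk hk₁ hk₂ hzero
  simp only [id, norm_eq_abs] at hpow
  rw [abs_of_nonneg (by positivity), abs_of_nonneg (by linarith)] at hpow
  set k₁ := ⌈k + log n ^ 2⌉₊ with hk₁_def
  have hc₁ : k + log n ^ 2 ≤ k₁ := Nat.le_ceil _
  have hc₂ : (k₁ : ℝ) < k + log n ^ 2 + 1 := Nat.ceil_lt_add_one (by positivity)
  have hl2 : 0 < log n ^ 2 := by positivity
  have hk₁0 : (0 : ℝ) < k₁ := by linarith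
  have hk₁' : 1 ≤ k₁ := by exact_mod_cast hk₁0
  have hlow := (hα (alpha0 2 n - 100) (by norm_num)).1
  have hup := (hα t (abs_le.2 ⟨by linarith, by linarith⟩)).2
  have hρk := div_mul_cancel₀ n hk.ne'
  set ρ := n / k with hρ
  have hρ0 : 0 < ρ := by linarith
  have hlt : n / k₁ < ρ := div_lt_div_of_pos_left (by linarith) hk (by linarith)
  have hρ₁ : ρ - 1 ≤ n / k₁ := by
    have h1 : ρ ^ 2 ≤ (4 * log n) ^ 2 := pow_le_pow_left₀ hρ0.le (by linarith) 2
    have h2 : ρ ^ 2 * (log n ^ 2 + 1) ≤ ρ * k := by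
      have : ρ ^ 2 * (log n ^ 2 + 1) ≤ (4 * log n) ^ 2 * (2 * log n ^ 2) :=
        mul_le_mul h1 (by nlinarith) (by positivity) (by positivity)
      nlinarith
    have h3 : ρ * (log n ^ 2 + 1) ≤ k := by
      refine le_of_mul_le_mul_left ?_ hρ0
      linarith
    rw [le_div_iff₀ hk₁0]
    nlinarith
  have hs := hslope t ht₁ (n / k₁) ρ (by linarith) hlt hk₂
  rw [hzero] at hs
  have h5 : log n ^ 4 / 2 ≤ k₁ * logRate n t (n / k₁) := by
    have h6 := le_mul_logRate (R := -logRate n t (n / k₁)) (l := -log n) hk₁0 hρk (by linarith)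
    have h7 : log n * log n ^ 2 ≤ ρ * (k₁ - k) :=
      mul_le_mul (by linarith) (by linarith) hl2.le hρ0.le
    nlinarith
  obtain ⟨_, ⟨q, hq, rfl⟩, hqlt⟩ := exists_lt_of_lt_csSup
    ((Ptilde_nonempty (ρ := n / k₁) (t := t) ⟨by linarith, by linarith⟩).image partEntropy)
    (show maxEntropy t (n / k₁) - 1 / k₁ < sSup (partEntropy '' Ptilde (n / k₁) t) from
      sub_lt_self _ (by positivity))
  have h8 : k₁ * maxEntropy t (n / k₁) - 1 ≤ k₁ * partEntropy q := by
    have := mul_le_mul_of_nonneg_left hqlt.le hk₁0.le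
    have h9 : (k₁ : ℝ) * (1 / k₁) = 1 := by field_simp
    linarith
  have h10 := mul_logRate_eq (n := n) (by linarith) hk₁0 t
  have h11 := log_add_one_le_two_mul (x := n) (by linarith) hn le_rfl
  have h12 := log_dI_le t
  have ht0 := t.cast_nonneg (α := ℝ)
  have h13 : (t : ℝ) ^ 2 ≤ (4 * log n) ^ 2 := pow_le_pow_left₀ ht0 hup 2
  have h14 : (t : ℝ) * (2 + 2 * log (n + 1) + log (dI t)) ≤ 4 * log n * (38 * log n ^ 2) := by
    refine (mul_le_mul_of_nonneg_left (b := 2 + 2 * log (n + 1) + log (dI t))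
      (c := 38 * log n ^ 2) (by nlinarith) ht0).trans ?_
    exact mul_le_mul_of_nonneg_right hup (by positivity)
  have h15 : 4 * log n * (38 * log n ^ 2) + 1 ≤ log n ^ 4 / 2 := by
    have h16 := mul_le_mul_of_nonneg_right hl (show 0 ≤ log n ^ 3 by positivity)
    have h17 := one_le_pow₀ (n := 3) (show 1 ≤ log n by linarith)
    linarith
  have hE := exp_le_EE (n := m) hk₁' (by rw [hm]; exact hq)
  rw [hm] at hE
  exact (one_le_exp (by linarith)).trans hE

theorem eventually_abs_sub_kThresh_le : ∀ᶠ n : ℝ in atTop, ∀ m t : ℕ, (m : ℝ) = n →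
    alpha0 2 n - 100 ≤ t → t ≤ alpha0 2 n + 100 → ∀ k : ℝ, 0 < k →
    alpha0 2 n - 100 ≤ n / k → n / k ≤ t → logRate n t (n / k) = 0 →
    |k - (kThresh m t : ℝ)| ≤ 2 * log n ^ 2 := by
  filter_upwards [eventually_sub_le_of_one_le_EE, eventually_one_le_EE,
    eventually_log_bounds 1 1 one_pos] with n hlow hup ⟨hl, _, _⟩ m t hm ht₁ ht₂ k hk hk₁ hk₂ hzero
  have hE := hup m t hm ht₁ ht₂ k hk hk₁ hk₂ hzero
  have h1 : 1 ≤ EE m (kThresh m t) t := Nat.sInf_mem (s := {k | 1 ≤ EE m k t}) ⟨_, hE⟩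
  have h2 := hlow m t _ hm ht₁ ht₂ k hk hk₁ hzero h1
  have h3 : kThresh m t ≤ ⌈k + log n ^ 2⌉₊ := Nat.sInf_le hE
  have h4 : (kThresh m t : ℝ) ≤ ⌈k + log n ^ 2⌉₊ := by exact_mod_cast h3
  have h5 := Nat.ceil_lt_add_one (show 0 ≤ k + log n ^ 2 by positivity)
  have h6 := one_le_pow₀ (n := 2) hl
  rw [abs_le]
  constructor <;> linarith

/-- The root of `logRate`, located through `muR`. -/
theorem exists_abs_root_sub_le : ∃ C : ℝ, ∀ᶠ n : ℝ in atTop, ∀ (t : ℕ) (ρ : ℝ),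
    |ρ - alpha0 2 n| ≤ 250 → ρ < t → logRate n t ρ = 0 →
    |ρ - ((alphaNat 2 n : ℝ) - 1 - 2 / log 2 + log (muR (1 / 2) (alphaNat 2 n) n) /
      (log n - log (log n)))| ≤ C / log n := by
  obtain ⟨C, hC⟩ := exists_logRate_muR_bound
  refine ⟨2 * C, ?_⟩
  filter_upwards [hC, eventually_log_bounds 1 (1 / 2) (by norm_num)]
    with n h ⟨hl, _, hll⟩ t ρ hρ hρt hzero
  have h1 := h t ρ hρ hρt
  rw [hzero] at h1
  have hD : 0 < log n - log (log n) := by linarith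
  have h2 : ρ - ((alphaNat 2 n : ℝ) - 1 - 2 / log 2 + log (muR (1 / 2) (alphaNat 2 n) n) /
      (log n - log (log n))) = (0 - (log (muR (1 / 2) (alphaNat 2 n) n) +
      (alphaNat 2 n - ρ - 1 - 2 / log 2) * (log n - log (log n)))) /
      (log n - log (log n)) := by
    rw [eq_div_iff hD.ne', sub_mul, add_mul, div_mul_cancel₀ _ hD.ne']
    ring
  rw [h2, abs_div, abs_of_pos hD, div_le_div_iff₀ hD (by linarith)]
  have h3 := (abs_nonneg _).trans h1
  nlinarith

/-- Take `p = 1/2`.  Let `β` be an integer-valued function on a set `W ⊆ ℝ`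
(a union of intervals), constant on each interval of `W`, with
`α₀(n) − 1 − 2/log 2 + ε ≤ β(n) ≤ α₀(n) + 100` for some constant `ε > 0` and all large
enough `n`.  Then for each large enough real `n ∈ W` there is a unique
`k* ∈ I_n = [n/(β(n)−ε/4), n/(α₀(n)−100)]` with `L̂₀(n,k*,β(n)) = 0`; moreover
`n/k* = α(n) − 1 − 2/log 2 + log μ_{α(n)}(n)/(log n − log log n) + O(1/log n)`, and if `n`
is an integer then `k* − k_{β(n)}(n) = O(log² n)`. -/
theorem kstar_unique (W : Set ℝ) (β : ℝ → ℕ) (ε : ℝ) (hε : 0 < ε)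
    (hβconst : ∀ x ∈ W, ∀ y ∈ W, Set.Icc x y ⊆ W → β x = β y)
    (hβ : ∃ n₁ : ℝ, ∀ n ∈ W, n₁ ≤ n →
      alpha0 2 n - 1 - 2 / Real.log 2 + ε ≤ (β n : ℝ) ∧ (β n : ℝ) ≤ alpha0 2 n + 100) :
    ∃ K n₀ : ℝ, ∀ n ∈ W, n₀ ≤ n →
      (∃! k : ℝ, k ∈ Set.Icc (n / ((β n : ℝ) - ε / 4)) (n / (alpha0 2 n - 100)) ∧
        Lhat0 n k (β n) = 0) ∧
      (∀ k : ℝ, k ∈ Set.Icc (n / ((β n : ℝ) - ε / 4)) (n / (alpha0 2 n - 100)) →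
        Lhat0 n k (β n) = 0 →
        |n / k - ((alphaNat 2 n : ℝ) - 1 - 2 / Real.log 2
            + Real.log (muR (1 / 2) (alphaNat 2 n) n)
                / (Real.log n - Real.log (Real.log n)))|
          ≤ K / Real.log n ∧
        ∀ m : ℕ, (m : ℝ) = n → |k - (kThresh m (β n) : ℝ)| ≤ K * Real.log n ^ 2) := by
  obtain ⟨n₁, hβ⟩ := hβ
  obtain ⟨C, hC⟩ := exists_abs_root_sub_le
  obtain ⟨n₀, hn₀⟩ := eventually_atTop.1 (((eventually_exists_logRate_eq_zero hε).and
    eventually_logRate_slope).and ((hC.and eventually_abs_sub_kThresh_le).and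
    (eventually_alpha_bounds.and (eventually_log_bounds 1000 1 one_pos))))
  refine ⟨max C 2, max n₀ (max n₁ 1), fun n hnW hn => ?_⟩
  obtain ⟨hn₀', hn₁, hn1⟩ : n₀ ≤ n ∧ n₁ ≤ n ∧ 1 ≤ n := by simpa using hn
  obtain ⟨⟨hex, hslope⟩, ⟨hasym, hthr⟩, ⟨-, -, hα⟩, hl, -, -⟩ := hn₀ n hn₀'
  obtain ⟨ht₁, ht₂⟩ := hβ n hnW hn₁
  generalize β n = t at ht₁ ht₂ ⊢
  obtain ⟨hl₁, hl₂⟩ := two_div_log_two_mem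
  have hn0 : 0 < n := by linarith
  have hlow := (hα (alpha0 2 n - 100) (by norm_num)).1
  have hkpos : ∀ k ∈ Set.Icc (n / ((t : ℝ) - ε / 4)) (n / (alpha0 2 n - 100)), 0 < k :=
    fun k hk => (div_pos hn0 (by linarith)).trans_le hk.1
  have hmem : ∀ k : ℝ, 0 < k → (k ∈ Set.Icc (n / ((t : ℝ) - ε / 4)) (n / (alpha0 2 n - 100)) ↔
      n / k ∈ Set.Icc (alpha0 2 n - 100) (t - ε / 4)) := by
    intro k hk
    rw [Set.mem_Icc, Set.mem_Icc, div_le_comm₀ (by linarith) hk,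
      le_div_comm₀ hk (by linarith), and_comm]
  have hL : ∀ k : ℝ, 0 < k → n / k ∈ Set.Icc (alpha0 2 n - 100) (t - ε / 4) →
      Lhat0 n k t = logRate n t (n / k) := fun k hk h =>
    Lhat0_eq_logRate hn0 hk (by linarith [h.1]) (by linarith [h.2])
  have hinj : ∀ x ∈ Set.Icc (alpha0 2 n - 100) (t - ε / 4),
      ∀ y ∈ Set.Icc (alpha0 2 n - 100) (t - ε / 4), logRate n t x = 0 → logRate n t y = 0 →
      ¬ x < y := by
    intro x hx y hy hx0 hy0 hxy
    have h := hslope t (by linarith) x y (by linarith [hx.1]) hxy (by linarith [hy.2])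
    rw [hx0, hy0] at h
    nlinarith
  constructor
  · obtain ⟨ρ, hρ, hρ0⟩ := hex t ht₁ ht₂
    have hρpos : 0 < ρ := by linarith [hρ.1]
    have hk : 0 < n / ρ := div_pos hn0 hρpos
    have hnk : n / (n / ρ) = ρ := by field_simp
    refine ⟨n / ρ, ⟨(hmem _ hk).2 (by rwa [hnk]), ?_⟩, ?_⟩
    · rw [hL _ hk (by rwa [hnk]), hnk, hρ0]
    · rintro k ⟨hkI, hk0⟩
      have hkp := hkpos k hkI
      have hkρ := (hmem k hkp).1 hkI
      rw [hL k hkp hkρ] at hk0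
      have h : n / k = ρ := le_antisymm (not_lt.1 (hinj _ hρ _ hkρ hρ0 hk0))
        (not_lt.1 (hinj _ hkρ _ hρ hk0 hρ0))
      rw [← h]
      field_simp
  · intro k hkI hk0
    have hkp := hkpos k hkI
    have hkρ := (hmem k hkp).1 hkI
    rw [hL k hkp hkρ] at hk0
    obtain ⟨h1, h2⟩ := hkρ
    refine ⟨?_, fun m hm => ?_⟩
    · refine (hasym t (n / k) (abs_le.2 ⟨by linarith, by linarith⟩) (by linarith) hk0).trans ?_
      exact div_le_div_of_nonneg_right (le_max_left _ _) (by linarith)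
    · refine (hthr m t hm (by linarith) ht₂ k hkp h1 (by linarith) hk0).trans ?_
      exact mul_le_mul_of_nonneg_right (le_max_right _ _) (by positivity)
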